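/- Almost surely, M_n = X_n Y_n Z_n converges to a limit M with M ∈ (0, 1/27), the sequence (X_n, Y_n, Z_n) does not converge, and the set of cluster points (limit points) of the sequence (X_n, Y_n, Z_n) is exactly {(x,y,z) ∈ Δ² : x y z = M}. Moreover the law of M gives positive probability to every nonempty open subinterval of (0, 1/27). -/

import Mathlib

open MeasureTheory ProbabilityTheory Filter Set Topology

noncomputable section

/-- `γ_n = γ₀ + 4 n`. -/
def rpsGamma (γ₀ : ℝ) (n : ℕ) : ℝ := γ₀ + 4 * n

/-- The increments to the (unnormalised) degrees of the three types
for each of the six possible transitions. -/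
def rpsIncr : Fin 6 → ℝ × ℝ × ℝ
  | 0 => (4, 0, 0)
  | 1 => (0, 4, 0)
  | 2 => (0, 0, 4)
  | 3 => (1, 3, 0)
  | 4 => (0, 1, 3)
  | 5 => (3, 0, 1)

/-- The conditional probability of each of the six possible transitions,
as a function of the current state `(x, y, z)`. -/
def rpsProb (i : Fin 6) (x y z : ℝ) : ℝ :=
  match i with
  | 0 => x ^ 2
  | 1 => y ^ 2
  | 2 => z ^ 2
  | 3 => 2 * x * y
  | 4 => 2 * y * z
  | 5 => 2 * z * x

/-- The rock–paper–scissors preferential attachment chain: an adapted process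
`(X n, Y n, Z n)` with values in the simplex `Δ²`, deterministic strictly positive initial
condition and, conditionally on `𝔉 n`, the six possible transitions have the prescribed
probabilities. -/
structure RPSChain {Ω : Type*} [MeasurableSpace Ω] (μ : Measure Ω) (γ₀ : ℝ) where
  F : Filtration ℕ ‹MeasurableSpace Ω›
  X : ℕ → Ω → ℝ
  Y : ℕ → Ω → ℝ
  Z : ℕ → Ω → ℝ
  adapted_X : Adapted F X
  adapted_Y : Adapted F Y
  adapted_Z : Adapted F Z
  nonneg_X : ∀ n ω, 0 ≤ X n ω
  nonneg_Y : ∀ n ω, 0 ≤ Y n ω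
  nonneg_Z : ∀ n ω, 0 ≤ Z n ω
  sum_eq_one : ∀ n ω, X n ω + Y n ω + Z n ω = 1
  init_X_pos : ∀ ω, 0 < X 0 ω
  init_Y_pos : ∀ ω, 0 < Y 0 ω
  init_Z_pos : ∀ ω, 0 < Z 0 ω
  init_X_const : ∀ ω ω', X 0 ω = X 0 ω'
  init_Y_const : ∀ ω ω', Y 0 ω = Y 0 ω'
  init_Z_const : ∀ ω ω', Z 0 ω = Z 0 ω'
  step : ∀ (n : ℕ) (i : Fin 6),
    μ[Set.indicator
        {ω | X (n+1) ω = (rpsGamma γ₀ n * X n ω + (rpsIncr i).1) / rpsGamma γ₀ (n+1) ∧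
             Y (n+1) ω = (rpsGamma γ₀ n * Y n ω + (rpsIncr i).2.1) / rpsGamma γ₀ (n+1) ∧
             Z (n+1) ω = (rpsGamma γ₀ n * Z n ω + (rpsIncr i).2.2) / rpsGamma γ₀ (n+1)}
        (fun _ => (1 : ℝ)) | F n]
      =ᵐ[μ] fun ω => rpsProb i (X n ω) (Y n ω) (Z n ω)

namespace RPSChain

variable {Ω : Type*} [MeasurableSpace Ω] {μ : Measure Ω} {γ₀ : ℝ}

lemma gam_succ (γ₀ : ℝ) (n : ℕ) : rpsGamma γ₀ (n+1) = rpsGamma γ₀ n + 4 := by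
  simp only [rpsGamma]; push_cast; ring

lemma gam_ge (h : 2 ≤ γ₀) (n : ℕ) : 2 ≤ rpsGamma γ₀ n := by
  simp only [rpsGamma]
  have : (0:ℝ) ≤ n := Nat.cast_nonneg n
  linarith

/-- event of transition `i` at time `n` -/
def Ev (c : RPSChain μ γ₀) (n : ℕ) (i : Fin 6) : Set Ω :=
  {ω | c.X (n+1) ω = (rpsGamma γ₀ n * c.X n ω + (rpsIncr i).1) / rpsGamma γ₀ (n+1) ∧
       c.Y (n+1) ω = (rpsGamma γ₀ n * c.Y n ω + (rpsIncr i).2.1) / rpsGamma γ₀ (n+1) ∧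
       c.Z (n+1) ω = (rpsGamma γ₀ n * c.Z n ω + (rpsIncr i).2.2) / rpsGamma γ₀ (n+1)}

/-- transition probability along the chain -/
def pr (c : RPSChain μ γ₀) (n : ℕ) (i : Fin 6) (ω : Ω) : ℝ :=
  rpsProb i (c.X n ω) (c.Y n ω) (c.Z n ω)

lemma mX (c : RPSChain μ γ₀) (n : ℕ) : Measurable[c.F n] (c.X n) := c.adapted_X n
lemma mY (c : RPSChain μ γ₀) (n : ℕ) : Measurable[c.F n] (c.Y n) := c.adapted_Y n
lemma mZ (c : RPSChain μ γ₀) (n : ℕ) : Measurable[c.F n] (c.Z n) := c.adapted_Z n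
lemma mX' (c : RPSChain μ γ₀) (n : ℕ) : Measurable (c.X n) := (c.mX n).mono (c.F.le n) le_rfl
lemma mY' (c : RPSChain μ γ₀) (n : ℕ) : Measurable (c.Y n) := (c.mY n).mono (c.F.le n) le_rfl
lemma mZ' (c : RPSChain μ γ₀) (n : ℕ) : Measurable (c.Z n) := (c.mZ n).mono (c.F.le n) le_rfl

lemma mEv (c : RPSChain μ γ₀) (n : ℕ) (i : Fin 6) : MeasurableSet (c.Ev n i) := by
  have h1 := c.mX' n
  have h2 := c.mY' n
  have h3 := c.mZ' n
  refine (measurableSet_eq_fun (c.mX' (n+1)) (by fun_prop)).inter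
    ((measurableSet_eq_fun (c.mY' (n+1)) (by fun_prop)).inter
      (measurableSet_eq_fun (c.mZ' (n+1)) (by fun_prop)))

lemma rpsIncr_inj : ∀ i j : Fin 6, (rpsIncr i).1 = (rpsIncr j).1 →
    (rpsIncr i).2.1 = (rpsIncr j).2.1 → i = j := by
  intro i j
  fin_cases i <;> fin_cases j <;> norm_num [rpsIncr]

lemma Ev_disj (hγ : 2 ≤ γ₀) (c : RPSChain μ γ₀) (n : ℕ) {i j : Fin 6} {ω : Ω}
    (hi : ω ∈ c.Ev n i) (hj : ω ∈ c.Ev n j) : i = j := by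
  have hg := gam_ge hγ (n+1)
  have hg' : rpsGamma γ₀ (n+1) ≠ 0 := by linarith
  obtain ⟨h1, h2, -⟩ := hi
  obtain ⟨k1, k2, -⟩ := hj
  rw [h1, div_left_inj' hg'] at k1
  rw [h2, div_left_inj' hg'] at k2
  exact rpsIncr_inj i j (by linarith) (by linarith)

lemma x_le (c : RPSChain μ γ₀) (n : ℕ) (ω : Ω) : c.X n ω ≤ 1 := by
  linarith [c.nonneg_Y n ω, c.nonneg_Z n ω, c.sum_eq_one n ω]
lemma y_le (c : RPSChain μ γ₀) (n : ℕ) (ω : Ω) : c.Y n ω ≤ 1 := by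
  linarith [c.nonneg_X n ω, c.nonneg_Z n ω, c.sum_eq_one n ω]
lemma z_le (c : RPSChain μ γ₀) (n : ℕ) (ω : Ω) : c.Z n ω ≤ 1 := by
  linarith [c.nonneg_Y n ω, c.nonneg_X n ω, c.sum_eq_one n ω]

lemma rpsProb_nonneg {x y z : ℝ} (hx : 0 ≤ x) (hy : 0 ≤ y) (hz : 0 ≤ z) (i : Fin 6) :
    0 ≤ rpsProb i x y z := by
  fin_cases i <;> simp only [rpsProb] <;> positivity

lemma rpsProb_sum {x y z : ℝ} (h : x + y + z = 1) : ∑ i, rpsProb i x y z = 1 := by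
  simp only [Fin.sum_univ_six, rpsProb]
  have : (x+y+z)^2 = 1 := by rw [h]; norm_num
  linarith

lemma pr_nonneg (c : RPSChain μ γ₀) (n : ℕ) (i : Fin 6) (ω : Ω) : 0 ≤ c.pr n i ω :=
  rpsProb_nonneg (c.nonneg_X n ω) (c.nonneg_Y n ω) (c.nonneg_Z n ω) i

lemma pr_sum (c : RPSChain μ γ₀) (n : ℕ) (ω : Ω) : ∑ i, c.pr n i ω = 1 :=
  rpsProb_sum (c.sum_eq_one n ω)

lemma pr_le (c : RPSChain μ γ₀) (n : ℕ) (i : Fin 6) (ω : Ω) : c.pr n i ω ≤ 1 := by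
  rw [← c.pr_sum n ω]
  exact Finset.single_le_sum (f := fun i => c.pr n i ω) (fun j _ => c.pr_nonneg n j ω)
    (Finset.mem_univ i)

lemma mpr (c : RPSChain μ γ₀) (n : ℕ) (i : Fin 6) : Measurable[c.F n] (c.pr n i) := by
  have h1 := c.mX n
  have h2 := c.mY n
  have h3 := c.mZ n
  unfold pr
  fin_cases i <;> simp only [rpsProb] <;> fun_prop

/-- integrability from a.e. bounds -/
lemma int_of_bdd [IsFiniteMeasure μ] {f : Ω → ℝ} (hf : AEMeasurable f μ) {K : ℝ}
    (hK : ∀ᵐ ω ∂μ, |f ω| ≤ K) : Integrable f μ :=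
  Integrable.of_bound hf.aestronglyMeasurable K hK

variable [IsProbabilityMeasure μ]

lemma step_one (c : RPSChain μ γ₀) (n : ℕ) (i : Fin 6) (g : Ω → ℝ)
    (hg : Measurable[c.F n] g) (K : ℝ) (hK : ∀ᵐ ω ∂μ, |g ω| ≤ K) :
    ∫ ω, g ω * (c.Ev n i).indicator (fun _ => (1:ℝ)) ω ∂μ = ∫ ω, g ω * c.pr n i ω ∂μ := by
  have hm := c.F.le n
  have hI : Integrable ((c.Ev n i).indicator (fun _ => (1:ℝ))) μ :=
    (integrable_const (1:ℝ)).indicator (c.mEv n i)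
  have h1 := condExp_stronglyMeasurable_mul_of_bound hm hg.stronglyMeasurable hI K hK
  have h2 := c.step n i
  calc ∫ ω, g ω * (c.Ev n i).indicator (fun _ => (1:ℝ)) ω ∂μ
      = ∫ ω, (μ[g * (c.Ev n i).indicator (fun _ => (1:ℝ)) | c.F n]) ω ∂μ :=
        (integral_condExp hm).symm
    _ = ∫ ω, g ω * c.pr n i ω ∂μ := by
        apply integral_congr_ae
        filter_upwards [h1, h2] with ω a b
        rw [a, Pi.mul_apply]
        congr 1

lemma ae_step1 (hγ : 2 ≤ γ₀) (c : RPSChain μ γ₀) (n : ℕ) : ∀ᵐ ω ∂μ, ∃ i, ω ∈ c.Ev n i := by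
  classical
  set S : Ω → ℝ := fun ω => ∑ i, (c.Ev n i).indicator (fun _ => (1:ℝ)) ω with hS
  have hint : ∀ i, Integrable ((c.Ev n i).indicator (fun _ => (1:ℝ))) μ := fun i =>
    (integrable_const (1:ℝ)).indicator (c.mEv n i)
  have hprI : ∀ i, Integrable (c.pr n i) μ := fun i =>
    int_of_bdd ((c.mpr n i).mono (c.F.le n) le_rfl).aemeasurable (K := 1)
      (ae_of_all _ fun ω => by rw [abs_of_nonneg (c.pr_nonneg n i ω)]; exact c.pr_le n i ω)
  have h1 : ∫ ω, S ω ∂μ = 1 := by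
    rw [hS, integral_finsetSum _ (fun i _ => hint i)]
    have : ∀ i, ∫ ω, (c.Ev n i).indicator (fun _ => (1:ℝ)) ω ∂μ = ∫ ω, c.pr n i ω ∂μ := by
      intro i
      have := c.step_one n i (fun _ => 1) measurable_const 1 (by simp)
      simpa using this
    simp_rw [this]
    rw [← integral_finsetSum _ (fun i _ => hprI i)]
    simp [c.pr_sum]
  have hle : ∀ ω, S ω ≤ 1 := by
    intro ω
    by_cases h : ∃ i, ω ∈ c.Ev n i
    · obtain ⟨i, hi⟩ := h
      simp only [hS]
      rw [Finset.sum_eq_single i]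
      · simp [hi]
      · intro j _ hji
        exact indicator_of_notMem (fun hj => hji (c.Ev_disj hγ n hj hi)) _
      · simp
    · push Not at h
      simp [hS, h]
  have hSI : Integrable S μ := integrable_finsetSum _ (fun i _ => hint i)
  have h0 : ∫ ω, (1 - S ω) ∂μ = 0 := by
    rw [integral_sub (integrable_const _) hSI, h1]; simp
  rw [integral_eq_zero_iff_of_nonneg (fun ω => sub_nonneg.2 (hle ω))
    ((integrable_const _).sub hSI)] at h0
  filter_upwards [h0] with ω h
  by_contra hc
  push Not at hc
  simp [hS, hc] at h

lemma ae_step (hγ : 2 ≤ γ₀) (c : RPSChain μ γ₀) : ∀ᵐ ω ∂μ, ∀ n, ∃ i, ω ∈ c.Ev n i :=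
  ae_all_iff.2 (c.ae_step1 hγ)

lemma step_int (hγ : 2 ≤ γ₀) (c : RPSChain μ γ₀) (n : ℕ) (g : Fin 6 → Ω → ℝ)
    (hg : ∀ i, Measurable[c.F n] (g i)) (K : ℝ) (hK : ∀ i, ∀ᵐ ω ∂μ, |g i ω| ≤ K)
    (G : Ω → ℝ) (hG : ∀ᵐ ω ∂μ, ∀ i, ω ∈ c.Ev n i → G ω = g i ω) :
    Integrable G μ ∧ Integrable (fun ω => ∑ i, c.pr n i ω * g i ω) μ ∧
    ∫ ω, G ω ∂μ = ∫ ω, ∑ i, c.pr n i ω * g i ω ∂μ := by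
  classical
  have hmg : ∀ i, Measurable (g i) := fun i => (hg i).mono (c.F.le n) le_rfl
  have hI1 : ∀ i, Integrable (fun ω => g i ω * (c.Ev n i).indicator (fun _ => (1:ℝ)) ω) μ := by
    intro i
    refine int_of_bdd (K := K)
      ((hmg i).mul ((measurable_const).indicator (c.mEv n i))).aemeasurable ?_
    filter_upwards [hK i] with ω h
    by_cases hh : ω ∈ c.Ev n i
    · simpa [hh] using h
    · simpa [hh] using (abs_nonneg _).trans h
  have hI2 : ∀ i, Integrable (fun ω => c.pr n i ω * g i ω) μ := by
    intro i
    refine int_of_bdd (K := K)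
      (((c.mpr n i).mono (c.F.le n) le_rfl).mul (hmg i)).aemeasurable ?_
    filter_upwards [hK i] with ω h
    rw [abs_mul, abs_of_nonneg (c.pr_nonneg n i ω)]
    nlinarith [c.pr_nonneg n i ω, c.pr_le n i ω, abs_nonneg (g i ω)]
  have hGe : G =ᵐ[μ] fun ω => ∑ i, g i ω * (c.Ev n i).indicator (fun _ => (1:ℝ)) ω := by
    filter_upwards [hG, c.ae_step1 hγ n] with ω h1 h2
    obtain ⟨i, hi⟩ := h2
    rw [Finset.sum_eq_single i]
    · simp [hi, h1 i hi]
    · intro j _ hji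
      rw [indicator_of_notMem (fun hj => hji (c.Ev_disj hγ n hj hi))]; simp
    · simp
  refine ⟨(integrable_finsetSum _ (fun i _ => hI1 i)).congr hGe.symm,
    integrable_finsetSum _ (fun i _ => hI2 i), ?_⟩
  rw [integral_congr_ae hGe, integral_finsetSum _ (fun i _ => hI1 i),
    integral_finsetSum _ (fun i _ => hI2 i)]
  refine Finset.sum_congr rfl fun i _ => ?_
  rw [c.step_one n i (g i) (hg i) K (hK i)]
  simp_rw [mul_comm]

end RPSChain

namespace RPSChain

def TM (γ : ℝ) (i : Fin 6) (x y z : ℝ) : ℝ :=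
  ((γ * x + (rpsIncr i).1) / (γ+4)) * ((γ * y + (rpsIncr i).2.1) / (γ+4)) *
    ((γ * z + (rpsIncr i).2.2) / (γ+4))

lemma prod_le {x y z : ℝ} (hx : 0 ≤ x) (hy : 0 ≤ y) (hz : 0 ≤ z) (h : x + y + z = 1) :
    (1-3*x)^2+(1-3*y)^2+(1-3*z)^2 ≤ 162 * (1/27 - x*y*z) := by
  obtain rfl : z = 1 - x - y := by linarith
  nlinarith [mul_nonneg hx (sq_nonneg (y-(1-x-y))), mul_nonneg hy (sq_nonneg (x-(1-x-y))),
    mul_nonneg hz (sq_nonneg (y-x))]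

lemma M_le {x y z : ℝ} (hx : 0 ≤ x) (hy : 0 ≤ y) (hz : 0 ≤ z) (h : x + y + z = 1) :
    x*y*z ≤ 1/27 := by
  have := prod_le hx hy hz h
  nlinarith [sq_nonneg (1-3*x), sq_nonneg (1-3*y), sq_nonneg (1-3*z)]

lemma L1 {γ x y z : ℝ} (hγ : 2 ≤ γ) (h : x + y + z = 1) :
    ∑ i, rpsProb i x y z * TM γ i x y z = x*y*z*(1 - (30*γ+64)/(γ+4)^3) := by
  have : γ + 4 ≠ 0 := by linarith
  obtain rfl : z = 1 - x - y := by linarith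
  simp only [Fin.sum_univ_six, rpsProb, TM, rpsIncr]
  field_simp
  ring

lemma pair_bd {γ x y : ℝ} (hγ : 2 ≤ γ) (hx : 0 ≤ x) (hy : 0 ≤ y) (h : x + y ≤ 1) :
    (γ^2*(y+3*x-12*x*y)+γ*(3-48*x*y)-64*x*y)^2 ≤ (20*γ^2)^2 := by
  have t0 : 0 ≤ x*y := by positivity
  have t1 : x*y ≤ 1/4 := by nlinarith [sq_nonneg (x-y)]
  have hg : 2*γ ≤ γ^2 := by nlinarith
  have hg2 : 4 ≤ γ^2 := by nlinarith
  have e : γ^2*(y+3*x-12*x*y)+γ*(3-48*x*y)-64*x*y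
    = γ^2*(y+3*x) + 3*γ - (x*y)*(12*γ^2+48*γ+64) := by ring
  rw [e]
  have a1 : (x*y)*(12*γ^2+48*γ+64) ≤ 1/4*(12*γ^2+48*γ+64) := by gcongr
  have a2 : 0 ≤ (x*y)*(12*γ^2+48*γ+64) := by positivity
  have a3 : γ^2*(y+3*x) ≤ γ^2*3 := by gcongr; linarith
  have a4 : 0 ≤ γ^2*(y+3*x) := by positivity
  apply sq_le_sq'
  · nlinarith
  · nlinarith

lemma one_bd {γ x : ℝ} (hγ : 2 ≤ γ) (hx : 0 ≤ x) (h : x ≤ 1) :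
    (4*γ^2 - x*(12*γ^2+48*γ+64))^2 ≤ (52*γ^2)^2 := by
  have hg : 2*γ ≤ γ^2 := by nlinarith
  have hg2 : 4 ≤ γ^2 := by nlinarith
  have a1 : x*(12*γ^2+48*γ+64) ≤ 1*(12*γ^2+48*γ+64) := by gcongr
  have a2 : 0 ≤ x*(12*γ^2+48*γ+64) := by positivity
  apply sq_le_sq'
  · nlinarith
  · nlinarith

lemma TM_sub {γ x y z : ℝ} (hγ : 2 ≤ γ) (i : Fin 6) : TM γ i x y z - x*y*z =
    (match i with
    | 0 => y*z*(4*γ^2 - x*(12*γ^2+48*γ+64))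
    | 1 => z*x*(4*γ^2 - y*(12*γ^2+48*γ+64))
    | 2 => x*y*(4*γ^2 - z*(12*γ^2+48*γ+64))
    | 3 => z*(γ^2*(y+3*x-12*x*y)+γ*(3-48*x*y)-64*x*y)
    | 4 => x*(γ^2*(z+3*y-12*y*z)+γ*(3-48*y*z)-64*y*z)
    | 5 => y*(γ^2*(x+3*z-12*z*x)+γ*(3-48*z*x)-64*z*x)) / (γ+4)^3 := by
  have : γ + 4 ≠ 0 := by linarith
  fin_cases i <;> simp only [TM, rpsIncr] <;> field_simp <;> ring

lemma L2a {γ x y z : ℝ} (hγ : 2 ≤ γ) (hx : 0 ≤ x) (hy : 0 ≤ y) (hz : 0 ≤ z)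
    (h : x + y + z = 1) :
    ∑ i, rpsProb i x y z * (TM γ i x y z - x*y*z)^2 ≤ 6480 * (x*y*z) / (γ+4)^2 := by
  have hM := M_le hx hy hz h
  have hM0 : 0 ≤ x*y*z := by positivity
  have o1 : ∀ u, 0 ≤ u → u ≤ 1 → ((x*y*z)*(4*γ^2 - u*(12*γ^2+48*γ+64)))^2
      ≤ (1/27*(x*y*z)) * (52*γ^2)^2 := by
    intro u h0 h1
    have := one_bd hγ h0 h1
    rw [mul_pow]
    have h2 : (x*y*z)^2 ≤ 1/27*(x*y*z) := by nlinarith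
    gcongr
  have o2 : ∀ u v w, 0 ≤ u → 0 ≤ v → u + v ≤ 1 → 0 ≤ w → w ≤ 1 → u*v*w = x*y*z →
      2*u*v*(w*(γ^2*(v+3*u-12*u*v)+γ*(3-48*u*v)-64*u*v))^2 ≤ (2*(x*y*z))*w*(20*γ^2)^2 := by
    intro u v w h0 h1 h2 h3 h4 h5
    have := pair_bd hγ h0 h1 h2
    rw [← h5]
    have e : 2*u*v*(w*(γ^2*(v+3*u-12*u*v)+γ*(3-48*u*v)-64*u*v))^2 =
      (2*(u*v*w))*w*((γ^2*(v+3*u-12*u*v)+γ*(3-48*u*v)-64*u*v))^2 := by ring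
    rw [e]; gcongr
  have p0 := o1 x hx (by linarith)
  have p1 := o1 y hy (by linarith)
  have p2 := o1 z hz (by linarith)
  have p3 := o2 x y z hx hy (by linarith) hz (by linarith) rfl
  have p4 := o2 y z x hy hz (by linarith) hx (by linarith) (by ring)
  have p5 := o2 z x y hz hx (by linarith) hy (by linarith) (by ring)
  have hg : 0 < γ + 4 := by linarith
  have key : ∑ i, rpsProb i x y z * (TM γ i x y z - x*y*z)^2
     ≤ (1200 * (x*y*z) * γ^4) / (γ+4)^6 := by
    simp only [TM_sub hγ]
    simp only [Fin.sum_univ_six, rpsProb, div_pow]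
    have e : ((γ+4)^3)^2 = (γ+4)^6 := by ring
    simp only [e, ← mul_div_assoc, ← add_div]
    apply div_le_div_of_nonneg_right _ (by positivity)
    have hs : (2*(x*y*z))*z*(20*γ^2)^2 + (2*(x*y*z))*x*(20*γ^2)^2 + (2*(x*y*z))*y*(20*γ^2)^2
      = 800 * (x*y*z)*γ^4 := by
      have : z = 1 - x - y := by linarith
      subst this; ring
    have hpos : 0 ≤ (x*y*z)*γ^4 := by positivity
    have e0 : ∀ n : ℝ, x^2*(y*z*n)^2 = ((x*y*z)*n)^2 := fun n => by ring
    have e1 : ∀ n : ℝ, y^2*(z*x*n)^2 = ((x*y*z)*n)^2 := fun n => by ring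
    have e2 : ∀ n : ℝ, z^2*(x*y*n)^2 = ((x*y*z)*n)^2 := fun n => by ring
    rw [e0, e1, e2]
    have e3 : (1/27*(x*y*z)) * (52*γ^2)^2 = 2704/27 * ((x*y*z)*γ^4) := by ring
    rw [e3] at p0 p1 p2
    calc _ ≤ 2704/27 * ((x*y*z)*γ^4) + 2704/27 * ((x*y*z)*γ^4) + 2704/27 * ((x*y*z)*γ^4)
          + (2*(x*y*z))*z*(20*γ^2)^2 + (2*(x*y*z))*x*(20*γ^2)^2 + (2*(x*y*z))*y*(20*γ^2)^2 := by
          gcongr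
      _ = 2704/9*((x*y*z)*γ^4) + 800 * (x*y*z)*γ^4 := by rw [← hs]; ring
      _ ≤ _ := by linarith
  refine key.trans ?_
  rw [div_le_div_iff₀ (by positivity) (by positivity)]
  have : γ^4 ≤ (γ+4)^4 := by gcongr; linarith
  calc 1200 * (x*y*z) * γ^4 * (γ+4)^2 ≤ 6480 * (x*y*z) * (γ+4)^4 * (γ+4)^2 := by
        gcongr; norm_num
    _ = _ := by ring

lemma L2b {γ x y z : ℝ} (hγ : 2 ≤ γ) (hx : 0 ≤ x) (hy : 0 ≤ y) (hz : 0 ≤ z)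
    (h : x + y + z = 1) (i : Fin 6) :
    (TM γ i x y z - x*y*z)^2 ≤ 6480 * (1/27 - x*y*z + 1/γ) / (γ+4)^2 := by
  have hM := M_le hx hy hz h
  have hM0 : 0 ≤ x*y*z := by positivity
  have hS := prod_le hx hy hz h
  have hg : 0 < γ + 4 := by linarith
  -- numerators
  have main : ∀ g r N : ℝ, N = γ^2*g + r → g^2 ≤ 20 * ((1-3*x)^2+(1-3*y)^2+(1-3*z)^2) →
      -(4*γ) ≤ r → r ≤ 4*γ → (N/(γ+4)^3)^2 ≤ 6480 * (1/27 - x*y*z + 1/γ) / (γ+4)^2 := by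
    intro g r N hN hgS hr1 hr2
    have hr : r^2 ≤ (4*γ)^2 := sq_le_sq' hr1 hr2
    have h1 : N^2 ≤ 2*γ^4*g^2 + 2*r^2 := by
      rw [hN]; nlinarith [sq_nonneg (γ^2*g - r)]
    have h2 : g^2 ≤ 3240*(1/27 - x*y*z) := by linarith
    have h3 : N^2 ≤ 6480*(1/27-x*y*z + 1/γ)*γ^4 := by
      have : γ^4*g^2 ≤ γ^4*(3240*(1/27 - x*y*z)) := by gcongr
      have e : 6480*(1/27-x*y*z + 1/γ)*γ^4 = 6480*(1/27-x*y*z)*γ^4 + 6480*γ^3 := by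
        field_simp
      rw [e]
      nlinarith [pow_pos (show (0:ℝ) < γ by linarith) 2]
    rw [div_pow, div_le_div_iff₀ (by positivity) (by positivity)]
    have hR : 0 ≤ 1/27 - x*y*z + 1/γ := by
      have : 0 ≤ 1/γ := by positivity
      linarith
    have : γ^4 ≤ (γ+4)^4 := by gcongr; linarith
    calc N^2*(γ+4)^2 ≤ 6480*(1/27-x*y*z + 1/γ)*(γ+4)^4*(γ+4)^2 := by
          gcongr; exact h3.trans (by gcongr)
      _ = _ := by ring
  have one : ∀ p u : ℝ, 0 ≤ p → p ≤ 1 → u ^ 2 ≤ (1-3*x)^2+(1-3*y)^2+(1-3*z)^2 →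
     (4*p*u)^2 ≤ 20 * ((1-3*x)^2+(1-3*y)^2+(1-3*z)^2) := by
    intro p u h0 h1 hu
    have : p^2 ≤ 1 := by nlinarith
    calc (4*p*u)^2 = 16*p^2*u^2 := by ring
      _ ≤ 16*1*u^2 := by gcongr
      _ ≤ _ := by nlinarith [sq_nonneg u]
  have two : ∀ p q u v : ℝ, 0 ≤ p → p ≤ 1 → 0 ≤ q → q ≤ 1 →
      u^2+v^2 ≤ (1-3*x)^2+(1-3*y)^2+(1-3*z)^2 →
     (p*u+3*q*v)^2 ≤ 20 * ((1-3*x)^2+(1-3*y)^2+(1-3*z)^2) := by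
    intro p q u v h0 h1 h2 h3 hu
    have hp : p^2*u^2 ≤ 1*u^2 := by gcongr; nlinarith
    have hq : q^2*v^2 ≤ 1*v^2 := by gcongr; nlinarith
    nlinarith [sq_nonneg (p*u-3*q*v), sq_nonneg u, sq_nonneg v]
  have bd : ∀ a b : ℝ, 0 ≤ a → a ≤ 1 → 0 ≤ b → b ≤ 1 → 0 ≤ a*b ∧ a*b ≤ 1 :=
    fun a b h0 h1 h2 h3 => ⟨by positivity, by nlinarith⟩
  have x1 : x ≤ 1 := by linarith
  have y1 : y ≤ 1 := by linarith
  have z1 : z ≤ 1 := by linarith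
  have q1 := sq_nonneg (1-3*x)
  have q2 := sq_nonneg (1-3*y)
  have q3 := sq_nonneg (1-3*z)
  have hMg : (x*y*z)*γ ≤ 1/27*γ := by gcongr
  have hMg0 : 0 ≤ (x*y*z)*γ := by positivity
  have bg : ∀ a : ℝ, 0 ≤ a → a ≤ 1 → 0 ≤ a*γ ∧ a*γ ≤ γ :=
    fun a h0 h1 => ⟨by positivity, by nlinarith⟩
  obtain ⟨gx0, gx1⟩ := bg x hx x1
  obtain ⟨gy0, gy1⟩ := bg y hy y1
  obtain ⟨gz0, gz1⟩ := bg z hz z1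
  clear bg
  rw [TM_sub hγ]
  fin_cases i <;> simp only
  · exact main (4*(y*z)*(1-3*x)) (-(48*γ+64)*(x*y*z)) _ (by ring)
      (one _ _ (bd y z hy y1 hz z1).1 (bd y z hy y1 hz z1).2 (by linarith))
      (by linarith) (by linarith)
  · exact main (4*(z*x)*(1-3*y)) (-(48*γ+64)*(x*y*z)) _ (by ring)
      (one _ _ (bd z x hz z1 hx x1).1 (bd z x hz z1 hx x1).2 (by linarith))
      (by linarith) (by linarith)
  · exact main (4*(x*y)*(1-3*z)) (-(48*γ+64)*(x*y*z)) _ (by ring)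
      (one _ _ (bd x y hx x1 hy y1).1 (bd x y hx x1 hy y1).2 (by linarith))
      (by linarith) (by linarith)
  · exact main ((z*y)*(1-3*x)+3*(z*x)*(1-3*y)) (3*(z*γ)-(48*γ+64)*(x*y*z)) _ (by ring)
      (two _ _ _ _ (bd z y hz z1 hy y1).1 (bd z y hz z1 hy y1).2
        (bd z x hz z1 hx x1).1 (bd z x hz z1 hx x1).2 (by linarith))
      (by linarith) (by linarith)
  · exact main ((x*z)*(1-3*y)+3*(x*y)*(1-3*z)) (3*(x*γ)-(48*γ+64)*(x*y*z)) _ (by ring)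
      (two _ _ _ _ (bd x z hx x1 hz z1).1 (bd x z hx x1 hz z1).2
        (bd x y hx x1 hy y1).1 (bd x y hx x1 hy y1).2 (by linarith))
      (by linarith) (by linarith)
  · exact main ((y*x)*(1-3*z)+3*(y*z)*(1-3*x)) (3*(y*γ)-(48*γ+64)*(x*y*z)) _ (by ring)
      (two _ _ _ _ (bd y x hy y1 hx x1).1 (bd y x hy y1 hx x1).2
        (bd y z hy y1 hz z1).1 (bd y z hy y1 hz z1).2 (by linarith))
      (by linarith) (by linarith)

lemma q_le {γ : ℝ} (hγ : 2 ≤ γ) : (30*γ+64)/(γ+4)^3 ≤ 30/(γ+4)^2 := by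
  rw [div_le_div_iff₀ (by positivity) (by positivity)]
  nlinarith [pow_pos (show (0:ℝ) < γ+4 by linarith) 2]

lemma q_ge {γ : ℝ} (hγ : 2 ≤ γ) :
    (1 - (30*γ+64)/(γ+4)^3) * (1 - 1/(γ+4)) ≤ 1 - 1/γ := by
  have h1 : 0 < γ := by linarith
  have h2 : 0 < γ + 4 := by linarith
  have : (1 - 1/γ) - (1 - (30*γ+64)/(γ+4)^3) * (1 - 1/(γ+4)) =
     ((30*γ+64)*γ*(γ+3) - 4*(γ+4)^3)/(γ*(γ+4)^4) := by
    field_simp; ring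
  have h3 : 0 ≤ ((30*γ+64)*γ*(γ+3) - 4*(γ+4)^3)/(γ*(γ+4)^4) := by
    apply div_nonneg
    · nlinarith [mul_nonneg (sub_nonneg.2 hγ) (sub_nonneg.2 hγ),
        mul_nonneg (mul_nonneg (sub_nonneg.2 hγ) (sub_nonneg.2 hγ)) (sub_nonneg.2 hγ)]
    · positivity
  linarith

/-- combined quadratic step -/
lemma L2 {γ x y z m : ℝ} (hγ : 2 ≤ γ) (hx : 0 ≤ x) (hy : 0 ≤ y) (hz : 0 ≤ z)
    (h : x + y + z = 1) (hm0 : 0 ≤ m) (hm : m ≤ 1/27) :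
    ∑ i, rpsProb i x y z * (TM γ i x y z - m)^2 ≤ (x*y*z - m)^2 + 7000*(x*y*z)/(γ+4)^2 ∧
    ∑ i, rpsProb i x y z * (TM γ i x y z - m)^2 ≤
      (x*y*z - m)^2 + 7000*(1/27 - x*y*z + 1/γ)/(γ+4)^2 := by
  have hM := M_le hx hy hz h
  have hM0 : 0 ≤ x*y*z := by positivity
  have hq := q_le hγ
  have hq0 : 0 ≤ (30*γ+64)/(γ+4)^3 := by positivity
  have e : ∑ i, rpsProb i x y z * (TM γ i x y z - m)^2 =
      ∑ i, rpsProb i x y z * (TM γ i x y z - x*y*z)^2 + (x*y*z-m)^2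
       - 2*(x*y*z-m)*(x*y*z)*((30*γ+64)/(γ+4)^3) := by
    have e1 : ∀ i, rpsProb i x y z * (TM γ i x y z - m)^2 =
      rpsProb i x y z * (TM γ i x y z - x*y*z)^2 +
       2*(x*y*z-m)*(rpsProb i x y z * TM γ i x y z) +
         ((x*y*z-m)^2 - 2*(x*y*z-m)*(x*y*z))*rpsProb i x y z := by intro i; ring
    simp_rw [e1]
    rw [Finset.sum_add_distrib, Finset.sum_add_distrib, ← Finset.mul_sum, ← Finset.mul_sum,
      L1 hγ h, rpsProb_sum h]
    ring
  set q := (30*γ+64)/(γ+4)^3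
  set Q := 1/(γ+4)^2 with hQ
  have hqQ : q ≤ 30*Q := by rw [hQ]; simpa [div_eq_mul_inv] using hq
  have hQ0 : 0 ≤ Q := by positivity
  constructor
  · have := L2a hγ hx hy hz h
    rw [e]
    have t : 6480 * (x*y*z) / (γ+4)^2 = 6480*(x*y*z)*Q := by rw [hQ]; ring
    have t' : 7000 * (x*y*z) / (γ+4)^2 = 7000*(x*y*z)*Q := by rw [hQ]; ring
    rw [t] at this; rw [t']
    have u1 : m*(x*y*z)*q ≤ 1/27*(x*y*z)*(30*Q) := by gcongr
    have u2 : 0 ≤ (x*y*z)*(x*y*z)*q := by positivity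
    have u3 : 0 ≤ (x*y*z)*Q := by positivity
    nlinarith
  · have this : ∑ i, rpsProb i x y z * (TM γ i x y z - x*y*z)^2 ≤
        6480 * (1/27 - x*y*z + 1/γ) / (γ+4)^2 := by
      calc _ ≤ ∑ i, rpsProb i x y z * (6480 * (1/27 - x*y*z + 1/γ) / (γ+4)^2) :=
            Finset.sum_le_sum fun i _ => mul_le_mul_of_nonneg_left (L2b hγ hx hy hz h i)
              (rpsProb_nonneg hx hy hz i)
        _ = _ := by rw [← Finset.sum_mul, rpsProb_sum h, one_mul]
    rw [e]
    have t : 6480 * (1/27 - x*y*z + 1/γ) / (γ+4)^2 = 6480*(1/27 - x*y*z + 1/γ)*Q := by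
      rw [hQ]; ring
    have t' : 7000 * (1/27 - x*y*z + 1/γ) / (γ+4)^2 = 7000*(1/27 - x*y*z + 1/γ)*Q := by
      rw [hQ]; ring
    rw [t] at this; rw [t']
    have hg : 0 ≤ 1/γ := by positivity
    have hW : 0 ≤ 1/27 - x*y*z := by linarith
    have u1 : (1/27 - x*y*z)*(x*y*z)*q ≤ (1/27 - x*y*z)*(1/27)*(30*Q) := by gcongr
    have u2 : 0 ≤ (1/27-m)*(x*y*z)*q := by
      have : 0 ≤ 1/27 - m := by linarith
      positivity
    have u3 : 0 ≤ (1/27 - x*y*z)*Q := by positivity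
    have u4 : 0 ≤ 1/γ*Q := by positivity
    nlinarith

end RPSChain

namespace RPSChain

lemma inv_add_le {A a : ℝ} (hA : 0 < A) (ha : 1 ≤ a) : 1/(A+a) ≤ 1/A - 1/(A*(A+1)) := by
  have : 1/A - 1/(A*(A+1)) = 1/(A+1) := by field_simp; ring
  rw [this]
  exact one_div_le_one_div_of_le (by linarith) (by linarith)

lemma L3aux {γ d A x : ℝ} (hγ : 2 ≤ γ) (hd : 0 < d) (hA : d ≤ A) (hx : A = γ * x)
    (hx1 : x ≤ 1) :
    1/A - x*(2-x)*(1/(A*(A+1))) ≤ (1 - d/(d+1)/γ)*(1/A) := by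
  have hA0 : 0 < A := by linarith
  have hx0 : 0 < x := by
    have : 0 < γ * x := hx ▸ hA0
    exact (pos_iff_pos_of_mul_pos this).1 (by linarith)
  have h1 : d/(d+1) ≤ A/(A+1) := by
    rw [div_le_div_iff₀ (by positivity) (by positivity)]; nlinarith
  have h2 : x * (1/(A*(A+1))) ≤ x*(2-x)*(1/(A*(A+1))) := by
    gcongr; nlinarith
  have h3 : x * (1/(A*(A+1))) = A/(A+1)/γ*(1/A) := by
    have : x = A/γ := by rw [hx]; field_simp
    rw [this]; field_simp
  have h4 : d/(d+1)/γ*(1/A) ≤ A/(A+1)/γ*(1/A) := by gcongr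
  have : (1 - d/(d+1)/γ)*(1/A) = 1/A - d/(d+1)/γ*(1/A) := by ring
  rw [this]; linarith

lemma L3 {γ x y z d : ℝ} (hγ : 2 ≤ γ) (hd : 0 < d) (hx : d ≤ γ*x) (hy : d ≤ γ*y) (hz : d ≤ γ*z)
    (h : x + y + z = 1) :
    ∑ i, rpsProb i x y z * (1/(γ*x+(rpsIncr i).1) + 1/(γ*y+(rpsIncr i).2.1) +
      1/(γ*z+(rpsIncr i).2.2)) ≤ (1 - d/(d+1)/γ)*(1/(γ*x)+1/(γ*y)+1/(γ*z)) := by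
  have hg : 0 < γ := by linarith
  have pos : ∀ u, d ≤ γ*u → 0 < u := fun u hu =>
    (pos_iff_pos_of_mul_pos (show 0 < γ * u by linarith)).1 hg
  have x0 := pos x hx
  have y0 := pos y hy
  have z0 := pos z hz
  have ax := L3aux hγ hd hx rfl (by linarith)
  have ay := L3aux hγ hd hy rfl (by linarith)
  have az := L3aux hγ hd hz rfl (by linarith)
  have bx : ∀ a : ℝ, 1 ≤ a → _ := fun a ha => inv_add_le (show 0 < γ*x by positivity) ha
  have bY : ∀ a : ℝ, 1 ≤ a → _ := fun a ha => inv_add_le (show 0 < γ*y by positivity) ha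
  have bz : ∀ a : ℝ, 1 ≤ a → _ := fun a ha => inv_add_le (show 0 < γ*z by positivity) ha
  simp only [Fin.sum_univ_six, rpsProb, rpsIncr, add_zero]
  set IX := 1/(γ*x) with hIX
  set IY := 1/(γ*y) with hIY
  set IZ := 1/(γ*z) with hIZ
  set JX := 1/(γ*x*(γ*x+1)) with hJX
  set JY := 1/(γ*y*(γ*y+1)) with hJY
  set JZ := 1/(γ*z*(γ*z+1)) with hJZ
  calc _ ≤ x^2*((IX - JX) + IY + IZ) + y^2*(IX+(IY-JY)+IZ) + z^2*(IX+IY+(IZ-JZ))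
        + 2*x*y*((IX-JX)+(IY-JY)+IZ) + 2*y*z*(IX+(IY-JY)+(IZ-JZ))
        + 2*z*x*((IX-JX)+IY+(IZ-JZ)) := by
        gcongr
        · exact bx 4 (by norm_num)
        · exact bY 4 (by norm_num)
        · exact bz 4 (by norm_num)
        · exact bx 1 (by norm_num)
        · exact bY 3 (by norm_num)
        · exact bY 1 (by norm_num)
        · exact bz 3 (by norm_num)
        · exact bx 3 (by norm_num)
        · exact bz 1 (by norm_num)
    _ = (IX - x*(2-x)*JX) + (IY - y*(2-y)*JY) + (IZ - z*(2-z)*JZ) := by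
        have : z = 1 - x - y := by linarith
        rw [this]; ring
    _ ≤ _ := by linarith

lemma frac_le {A a : ℝ} (hA : 0 < A) (ha : 0 ≤ a) : A/(A+a) ≤ 1 - a/A + (a/A)^2 := by
  have : 1 - a/A + (a/A)^2 - A/(A+a) = a^3/(A^2*(A+a)) := by field_simp; ring
  have h : 0 ≤ a^3/(A^2*(A+a)) := by positivity
  linarith

lemma frac2_le {A B : ℝ} (hA : 81 ≤ A) (hB : 81 ≤ B) :
    A/(A+1)*(B/(B+3)) ≤ 1 - 1/A - 3/B + 3/2*((1/A)^2+(3/B)^2) := by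
  have h1 := frac_le (show 0 < A by linarith) (show (0:ℝ) ≤ 1 by norm_num)
  have h2 := frac_le (show 0 < B by linarith) (show (0:ℝ) ≤ 3 by norm_num)
  have u0 : 0 ≤ 1/A := by positivity
  have v0 : 0 ≤ 3/B := by positivity
  have u1 : 1/A ≤ 1 := by rw [div_le_one (by linarith)]; linarith
  have v1 : 3/B ≤ 1 := by rw [div_le_one (by linarith)]; linarith
  set u := 1/A
  set v := 3/B
  have hb : 0 ≤ B/(B+3) := by positivity
  have ha : 0 ≤ 1 - u + u^2 := by nlinarith
  calc A/(A+1)*(B/(B+3)) ≤ (1-u+u^2)*(1-v+v^2) := by gcongr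
    _ ≤ _ := by nlinarith [sq_nonneg (u-v), mul_nonneg (mul_nonneg u0 v0) (sub_nonneg.2 u1),
        mul_nonneg (mul_nonneg u0 v0) v0, mul_nonneg (mul_nonneg (mul_nonneg u0 v0) v0) (sub_nonneg.2 u1),
        mul_nonneg (mul_nonneg u0 v0) u0]

lemma L4aux1 {γ x : ℝ} (hγ : 243 ≤ γ) (hx : 81 ≤ γ*x) :
    x^2*((γ*x)/(γ*x+4)) ≤ x^2 - 4*x/γ + 1/(15*γ) := by
  have hx0 : 0 < x := (pos_iff_pos_of_mul_pos (show 0 < γ * x by linarith)).1 (by linarith)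
  have := frac_le (show 0 < γ*x by linarith) (show (0:ℝ) ≤ 4 by norm_num)
  calc x^2*((γ*x)/(γ*x+4)) ≤ x^2*(1 - 4/(γ*x) + (4/(γ*x))^2) := by gcongr
    _ = x^2 - 4*x/γ + 16/(γ*γ) := by field_simp; ring
    _ ≤ x^2 - 4*x/γ + 16/(γ*243) := by gcongr
    _ ≤ _ := by
      have : 16/(γ*243) = 16/243*(1/γ) := by field_simp
      have h2 : 1/(15*γ) = 1/15*(1/γ) := by field_simp
      have : 0 < 1/γ := by positivity
      linarith

lemma L4aux2 {γ x y : ℝ} (hγ : 243 ≤ γ) (hx : 81 ≤ γ*x) (hy : 81 ≤ γ*y) :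
    2*x*y*((γ*x)/(γ*x+1)*((γ*y)/(γ*y+3))) ≤ 2*x*y - (2*y+6*x)/γ + (y+9*x)/(27*γ) := by
  have hx0 : 0 < x := (pos_iff_pos_of_mul_pos (show 0 < γ * x by linarith)).1 (by linarith)
  have hy0 : 0 < y := (pos_iff_pos_of_mul_pos (show 0 < γ * y by linarith)).1 (by linarith)
  have := frac2_le hx hy
  calc _ ≤ 2*x*y*(1 - 1/(γ*x) - 3/(γ*y) + 3/2*((1/(γ*x))^2+(3/(γ*y))^2)) := by gcongr
    _ = 2*x*y - (2*y+6*x)/γ + 3*(y/(γ*(γ*x)) + 9*x/(γ*(γ*y))) := by field_simp; ring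
    _ ≤ 2*x*y - (2*y+6*x)/γ + 3*(y/(γ*81) + 9*x/(γ*81)) := by gcongr
    _ = _ := by field_simp; ring

lemma L4 {γ x y z : ℝ} (hx : 81 ≤ γ*x) (hy : 81 ≤ γ*y) (hz : 81 ≤ γ*z)
    (h : x + y + z = 1) :
    ∑ i, rpsProb i x y z * (1/((γ+4)*TM γ i x y z)) ≤ (1 - 1/γ)*(1/(γ*(x*y*z))) := by
  have hγ : 243 ≤ γ := by
    have : γ = γ*x+γ*y+γ*z := by rw [← mul_add, ← mul_add, h, mul_one]
    linarith
  have hg : 0 < γ := by linarith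
  have hx0 : 0 < x := (pos_iff_pos_of_mul_pos (show 0 < γ * x by linarith)).1 hg
  have hy0 : 0 < y := (pos_iff_pos_of_mul_pos (show 0 < γ * y by linarith)).1 hg
  have hz0 : 0 < z := (pos_iff_pos_of_mul_pos (show 0 < γ * z by linarith)).1 hg
  have a0 := L4aux1 hγ hx
  have a1 := L4aux1 hγ hy
  have a2 := L4aux1 hγ hz
  have a3 := L4aux2 hγ hx hy
  have a4 := L4aux2 hγ hy hz
  have a5 := L4aux2 hγ hz hx
  have e : ∑ i, rpsProb i x y z * (1/((γ+4)*TM γ i x y z)) =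
     ((γ+4)^2/γ^2)*(1/(γ*(x*y*z)))*(x^2*((γ*x)/(γ*x+4)) + y^2*((γ*y)/(γ*y+4)) +
       z^2*((γ*z)/(γ*z+4)) + 2*x*y*((γ*x)/(γ*x+1)*((γ*y)/(γ*y+3))) +
       2*y*z*((γ*y)/(γ*y+1)*((γ*z)/(γ*z+3))) + 2*z*x*((γ*z)/(γ*z+1)*((γ*x)/(γ*x+3)))) := by
    simp only [Fin.sum_univ_six, rpsProb, TM, rpsIncr, add_zero, mul_add]
    congr 1
    · congr 1
      · congr 1
        · congr 1
          · congr 1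
            · field_simp
            · field_simp
          · field_simp
        · field_simp
      · field_simp
    · field_simp
  rw [e]
  have s : x^2*((γ*x)/(γ*x+4)) + y^2*((γ*y)/(γ*y+4)) +
       z^2*((γ*z)/(γ*z+4)) + 2*x*y*((γ*x)/(γ*x+1)*((γ*y)/(γ*y+3))) +
       2*y*z*((γ*y)/(γ*y+1)*((γ*z)/(γ*z+3))) + 2*z*x*((γ*z)/(γ*z+1)*((γ*x)/(γ*x+3)))
       ≤ 1 - 11/γ := by
    have t : (x^2 - 4*x/γ + 1/(15*γ)) + (y^2 - 4*y/γ + 1/(15*γ)) + (z^2 - 4*z/γ + 1/(15*γ)) +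
      (2*x*y - (2*y+6*x)/γ + (y+9*x)/(27*γ)) + (2*y*z - (2*z+6*y)/γ + (z+9*y)/(27*γ)) +
      (2*z*x - (2*x+6*z)/γ + (x+9*z)/(27*γ)) = 1 - 12/γ + (1/5+10/27)*(1/γ) := by
      have : z = 1 - x - y := by linarith
      rw [this]; field_simp; ring
    have h1 : 0 < 1/γ := by positivity
    have h2 : 12/γ = 12*(1/γ) := by ring
    have h3 : 11/γ = 11*(1/γ) := by ring
    rw [h3]; rw [h2] at t
    linarith
  have f : (γ+4)^2/γ^2*(1-11/γ) ≤ 1 - 1/γ := by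
    have : (1 - 1/γ) - (γ+4)^2/γ^2*(1-11/γ) = (2*γ^2+72*γ+176)/γ^3 := by field_simp; ring
    have : 0 ≤ (2*γ^2+72*γ+176)/γ^3 := by positivity
    linarith
  calc _ ≤ ((γ+4)^2/γ^2)*(1/(γ*(x*y*z)))*(1-11/γ) := by gcongr
    _ = ((γ+4)^2/γ^2*(1-11/γ))*(1/(γ*(x*y*z))) := by ring
    _ ≤ _ := by gcongr

/-- martingale noise of the linear functional `α x + β y` -/
def xi (α β γ : ℝ) (i : Fin 6) (x y z : ℝ) : ℝ :=
  (α * (rpsIncr i).1 + β * (rpsIncr i).2.1 - 4*(α*x+β*y) - (2*α*x*(z-y)+2*β*y*(x-z)))/(γ+4)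

lemma L5 {α β γ x y z : ℝ} (h : x + y + z = 1) :
    ∑ i, rpsProb i x y z * xi α β γ i x y z = 0 := by
  simp only [Fin.sum_univ_six, rpsProb, xi, rpsIncr, ← mul_div_assoc, ← add_div]
  rw [div_eq_zero_iff]; left
  have : z = 1 - x - y := by linarith
  rw [this]; ring

lemma xi_sq {α β γ x y z : ℝ} (hγ : 2 ≤ γ) (hx : 0 ≤ x) (hy : 0 ≤ y) (hz : 0 ≤ z)
    (h : x + y + z = 1) (hα : 0 ≤ α) (hβ : 0 ≤ β) (hα1 : α ≤ 1) (hβ1 : β ≤ 1) (i : Fin 6) :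
    (xi α β γ i x y z)^2 ≤ 400/(γ+4)^2 := by
  unfold xi
  rw [div_pow]
  apply div_le_div_of_nonneg_right _ (by positivity)
  have i1 : 0 ≤ (rpsIncr i).1 ∧ (rpsIncr i).1 ≤ 4 := by
    fin_cases i <;> norm_num [rpsIncr]
  have i2 : 0 ≤ (rpsIncr i).2.1 ∧ (rpsIncr i).2.1 ≤ 4 := by
    fin_cases i <;> norm_num [rpsIncr]
  obtain ⟨a0, a1⟩ := i1
  obtain ⟨b0, b1⟩ := i2
  have t1 : 0 ≤ α * (rpsIncr i).1 ∧ α * (rpsIncr i).1 ≤ 4 := ⟨by positivity, by nlinarith⟩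
  have t2 : 0 ≤ β * (rpsIncr i).2.1 ∧ β * (rpsIncr i).2.1 ≤ 4 := ⟨by positivity, by nlinarith⟩
  have t3 : 0 ≤ α*x ∧ α*x ≤ x := ⟨by positivity, by nlinarith⟩
  have t4 : 0 ≤ β*y ∧ β*y ≤ y := ⟨by positivity, by nlinarith⟩
  have zy : |z-y| ≤ 1 := by rw [abs_le]; constructor <;> linarith
  have xz : |x-z| ≤ 1 := by rw [abs_le]; constructor <;> linarith
  have t5 : |(α*x)*(z-y)| ≤ x := by
    rw [abs_mul, abs_of_nonneg t3.1]; nlinarith [abs_nonneg (z-y)]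
  have t6 : |(β*y)*(x-z)| ≤ y := by
    rw [abs_mul, abs_of_nonneg t4.1]; nlinarith [abs_nonneg (x-z)]
  rw [abs_le] at t5 t6
  have : (400:ℝ) = 20^2 := by norm_num
  rw [this]
  apply sq_le_sq'
  · linarith
  · linarith

end RPSChain

namespace RPSChain
variable {Ω : Type*} [MeasurableSpace Ω] {μ : Measure Ω} {γ₀ : ℝ}

def MM (c : RPSChain μ γ₀) (n : ℕ) (ω : Ω) : ℝ := c.X n ω * c.Y n ω * c.Z n ω

lemma MM_nonneg (c : RPSChain μ γ₀) (n : ℕ) (ω : Ω) : 0 ≤ c.MM n ω :=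
  mul_nonneg (mul_nonneg (c.nonneg_X n ω) (c.nonneg_Y n ω)) (c.nonneg_Z n ω)
lemma MM_le (c : RPSChain μ γ₀) (n : ℕ) (ω : Ω) : c.MM n ω ≤ 1/27 :=
  M_le (c.nonneg_X n ω) (c.nonneg_Y n ω) (c.nonneg_Z n ω) (c.sum_eq_one n ω)
lemma mMM (c : RPSChain μ γ₀) (n : ℕ) : Measurable[c.F n] (c.MM n) :=
  ((c.mX n).mul (c.mY n)).mul (c.mZ n)
lemma mMM' (c : RPSChain μ γ₀) (n : ℕ) : Measurable (c.MM n) := (c.mMM n).mono (c.F.le n) le_rfl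

lemma MM_succ (c : RPSChain μ γ₀) (n : ℕ) (i : Fin 6) (ω : Ω) (h : ω ∈ c.Ev n i) :
    c.MM (n+1) ω = TM (rpsGamma γ₀ n) i (c.X n ω) (c.Y n ω) (c.Z n ω) := by
  obtain ⟨h1, h2, h3⟩ := h
  simp only [MM, TM]
  rw [h1, h2, h3, gam_succ]

def TMc (c : RPSChain μ γ₀) (n : ℕ) (i : Fin 6) (ω : Ω) : ℝ :=
  TM (rpsGamma γ₀ n) i (c.X n ω) (c.Y n ω) (c.Z n ω)

lemma mTMc (c : RPSChain μ γ₀) (n : ℕ) (i : Fin 6) : Measurable[c.F n] (c.TMc n i) := by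
  have h1 := c.mX n
  have h2 := c.mY n
  have h3 := c.mZ n
  unfold TMc TM
  fun_prop

lemma rpsIncr_nonneg (i : Fin 6) : 0 ≤ (rpsIncr i).1 ∧ 0 ≤ (rpsIncr i).2.1 ∧ 0 ≤ (rpsIncr i).2.2 ∧
    (rpsIncr i).1 + (rpsIncr i).2.1 + (rpsIncr i).2.2 = 4 := by
  fin_cases i <;> norm_num [rpsIncr]

lemma TM_mem {γ x y z : ℝ} (hγ : 2 ≤ γ) (hx : 0 ≤ x) (hy : 0 ≤ y) (hz : 0 ≤ z)
    (h : x + y + z = 1) (i : Fin 6) : 0 ≤ TM γ i x y z ∧ TM γ i x y z ≤ 1/27 := by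
  obtain ⟨h1, h2, h3, h4⟩ := rpsIncr_nonneg i
  have hg : 0 < γ + 4 := by linarith
  refine ⟨by unfold TM; positivity, M_le (by positivity) (by positivity) (by positivity) ?_⟩
  rw [← add_div, ← add_div, div_eq_one_iff_eq hg.ne']
  have : γ*(x+y+z) = γ := by rw [h, mul_one]
  linarith

lemma TMc_nonneg (hγ : 2 ≤ γ₀) (c : RPSChain μ γ₀) (n : ℕ) (i : Fin 6) (ω : Ω) :
    0 ≤ c.TMc n i ω :=
  (TM_mem (gam_ge hγ n) (c.nonneg_X n ω) (c.nonneg_Y n ω) (c.nonneg_Z n ω) (c.sum_eq_one n ω) i).1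
lemma TMc_le (hγ : 2 ≤ γ₀) (c : RPSChain μ γ₀) (n : ℕ) (i : Fin 6) (ω : Ω) :
    c.TMc n i ω ≤ 1/27 :=
  (TM_mem (gam_ge hγ n) (c.nonneg_X n ω) (c.nonneg_Y n ω) (c.nonneg_Z n ω) (c.sum_eq_one n ω) i).2

/-- admissible weights at time `n` -/
def Wt (c : RPSChain μ γ₀) (n : ℕ) (h : Ω → ℝ) : Prop :=
  Measurable[c.F n] h ∧ (∀ ω, 0 ≤ h ω) ∧ ∃ K, ∀ᵐ ω ∂μ, h ω ≤ K

lemma Wt.mono {c : RPSChain μ γ₀} {n k : ℕ} {h : Ω → ℝ} (hw : c.Wt n h) (hk : n ≤ k) :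
    c.Wt k h := ⟨hw.1.mono (c.F.mono hk) le_rfl, hw.2⟩

lemma Wt.meas {c : RPSChain μ γ₀} {n : ℕ} {h : Ω → ℝ} (hw : c.Wt n h) : Measurable h :=
  hw.1.mono (c.F.le n) le_rfl

variable [IsProbabilityMeasure μ]

lemma Wt.int {c : RPSChain μ γ₀} {n : ℕ} {h : Ω → ℝ} (hw : c.Wt n h) {f : Ω → ℝ}
    (hf : AEMeasurable f μ) (B : ℝ) (hB : ∀ᵐ ω ∂μ, |f ω| ≤ B) :
    Integrable (fun ω => h ω * f ω) μ := by
  obtain ⟨h1, h2, K, hK⟩ := hw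
  refine int_of_bdd (K := K * B) (((h1.mono (c.F.le n) le_rfl).aemeasurable).mul hf) ?_
  filter_upwards [hK, hB] with ω a b
  rw [abs_mul, abs_of_nonneg (h2 ω)]
  have := h2 ω
  gcongr
  linarith

lemma Wt.int1 {c : RPSChain μ γ₀} {n : ℕ} {h : Ω → ℝ} (hw : c.Wt n h) : Integrable h μ := by
  simpa using hw.int (f := fun _ => 1) (by fun_prop) 1 (by simp)

lemma MM_abs (c : RPSChain μ γ₀) (n : ℕ) (ω : Ω) : |c.MM n ω| ≤ 1 := by
  rw [abs_of_nonneg (c.MM_nonneg n ω)]; linarith [c.MM_le n ω]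

lemma Wt.intM {c : RPSChain μ γ₀} {n : ℕ} {h : Ω → ℝ} (hw : c.Wt n h) (k : ℕ) :
    Integrable (fun ω => h ω * c.MM k ω) μ :=
  hw.int (c.mMM' k).aemeasurable 1 (ae_of_all _ (c.MM_abs k))

lemma MM_sub_sq (c : RPSChain μ γ₀) (n k : ℕ) (ω : Ω) : (c.MM k ω - c.MM n ω)^2 ≤ 1 := by
  have := c.MM_nonneg n ω
  have := c.MM_nonneg k ω
  have := c.MM_le n ω
  have := c.MM_le k ω
  nlinarith

lemma Wt.intQ {c : RPSChain μ γ₀} {n : ℕ} {h : Ω → ℝ} (hw : c.Wt n h) (k l : ℕ) :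
    Integrable (fun ω => h ω * (c.MM k ω - c.MM l ω)^2) μ :=
  hw.int (((c.mMM' k).sub (c.mMM' l)).pow_const 2).aemeasurable 1 (ae_of_all _ fun ω => by
    rw [abs_of_nonneg (sq_nonneg _)]; exact c.MM_sub_sq l k ω)

/-- exact one step mean -/
lemma M_step (hγ : 2 ≤ γ₀) (c : RPSChain μ γ₀) (k : ℕ) (h : Ω → ℝ) (hw : c.Wt k h) :
    ∫ ω, h ω * c.MM (k+1) ω ∂μ =
      (1 - (30*rpsGamma γ₀ k+64)/(rpsGamma γ₀ k+4)^3) * ∫ ω, h ω * c.MM k ω ∂μ := by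
  obtain ⟨h1, h2, K, hK⟩ := hw
  obtain ⟨-, -, e⟩ := c.step_int hγ k (fun i ω => h ω * c.TMc k i ω)
    (fun i => h1.mul (c.mTMc k i)) K (by
      intro i
      filter_upwards [hK] with ω a
      rw [abs_of_nonneg (mul_nonneg (h2 ω) (c.TMc_nonneg hγ k i ω))]
      have := c.TMc_le hγ k i ω
      have := c.TMc_nonneg hγ k i ω
      nlinarith [h2 ω]) (fun ω => h ω * c.MM (k+1) ω)
    (ae_of_all _ fun ω i hi => by simp only [TMc]; rw [c.MM_succ k i ω hi])
  rw [e, ← integral_const_mul]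
  congr 1; ext ω
  have := L1 (gam_ge hγ k) (c.sum_eq_one k ω)
  calc ∑ i, c.pr k i ω * (h ω * c.TMc k i ω) = h ω * ∑ i, c.pr k i ω * c.TMc k i ω := by
        rw [Finset.mul_sum]; congr 1; ext i; ring
    _ = _ := by
        simp only [pr, TMc, MM]
        rw [this]; ring

lemma gam_tel (hγ : 2 ≤ γ₀) (k : ℕ) : 1/(rpsGamma γ₀ k + 4)^2 ≤
    (1/rpsGamma γ₀ k - 1/rpsGamma γ₀ (k+1))/4 := by
  rw [gam_succ]
  have := gam_ge hγ k
  set g := rpsGamma γ₀ k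
  have e : (1/g - 1/(g+4))/4 = 1/(g*(g+4)) := by field_simp; ring
  rw [e, sq]
  apply one_div_le_one_div_of_le (by positivity)
  gcongr; linarith

lemma intM_nonneg (c : RPSChain μ γ₀) {n : ℕ} {h : Ω → ℝ} (hw : c.Wt n h) (k : ℕ) :
    0 ≤ ∫ ω, h ω * c.MM k ω ∂μ :=
  integral_nonneg fun ω => mul_nonneg (hw.2.1 ω) (c.MM_nonneg k ω)

lemma q_nn (hγ : 2 ≤ γ₀) (k : ℕ) :
    0 ≤ (30*rpsGamma γ₀ k+64)/(rpsGamma γ₀ k+4)^3 := by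
  have := gam_ge hγ k
  positivity

lemma M_decr (hγ : 2 ≤ γ₀) (c : RPSChain μ γ₀) (n : ℕ) (h : Ω → ℝ) (hw : c.Wt n h) (k : ℕ)
    (hk : n ≤ k) : ∫ ω, h ω * c.MM k ω ∂μ ≤ ∫ ω, h ω * c.MM n ω ∂μ := by
  induction k, hk using Nat.le_induction with
  | base => rfl
  | succ k hk ih =>
    rw [c.M_step hγ k h (hw.mono hk)]
    have := q_nn hγ k
    have := c.intM_nonneg hw k
    nlinarith

lemma M_decr2 (hγ : 2 ≤ γ₀) (c : RPSChain μ γ₀) (n : ℕ) (h : Ω → ℝ) (hw : c.Wt n h) (k : ℕ)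
    (hk : n ≤ k) : (1-1/rpsGamma γ₀ k)*∫ ω, h ω * c.MM k ω ∂μ ≤
      (1-1/rpsGamma γ₀ n)*∫ ω, h ω * c.MM n ω ∂μ := by
  induction k, hk using Nat.le_induction with
  | base => rfl
  | succ k hk ih =>
    refine le_trans ?_ ih
    rw [c.M_step hγ k h (hw.mono hk), gam_succ]
    have := q_ge (gam_ge hγ k)
    have := c.intM_nonneg hw k
    nlinarith

lemma M_incr (hγ : 2 ≤ γ₀) (c : RPSChain μ γ₀) (n : ℕ) (h : Ω → ℝ) (hw : c.Wt n h) (k : ℕ)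
    (hk : n ≤ k) : ∫ ω, h ω * c.MM n ω ∂μ - (1/rpsGamma γ₀ n - 1/rpsGamma γ₀ k)*∫ ω, h ω ∂μ ≤
      ∫ ω, h ω * c.MM k ω ∂μ := by
  induction k, hk using Nat.le_induction with
  | base => simp
  | succ k hk ih =>
    rw [c.M_step hγ k h (hw.mono hk)]
    have h1 := gam_tel hγ k
    have h2 := q_le (gam_ge hγ k)
    have h3 := c.intM_nonneg hw k
    have h4 : ∫ ω, h ω * c.MM k ω ∂μ ≤ 1/27*∫ ω, h ω ∂μ := by
      rw [← integral_const_mul]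
      apply integral_mono (hw.intM k) (hw.int1.const_mul _)
      intro ω
      have := c.MM_le k ω
      have := hw.2.1 ω
      dsimp only
      nlinarith
    set I := ∫ ω, h ω * c.MM k ω ∂μ
    have h0 := q_nn hγ k
    set q := (30*rpsGamma γ₀ k+64)/(rpsGamma γ₀ k+4)^3
    have h5 : q ≤ 30*((1/rpsGamma γ₀ k - 1/rpsGamma γ₀ (k+1))/4) := by
      refine h2.trans (le_trans (le_of_eq ?_) (mul_le_mul_of_nonneg_left h1 (by norm_num)))
      ring
    have hh : 0 ≤ ∫ ω, h ω ∂μ := integral_nonneg hw.2.1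
    set J := ∫ ω, h ω ∂μ
    have h6 : q*I ≤ 30*((1/rpsGamma γ₀ k - 1/rpsGamma γ₀ (k+1))/4)*(1/27*J) := by
      gcongr
      linarith
    have h7 : 0 ≤ (1/rpsGamma γ₀ k - 1/rpsGamma γ₀ (k+1))*J :=
      mul_nonneg (by linarith) hh
    nlinarith

/-- one step for squares; `U` is either of the two controls -/
lemma Q_step (hγ : 2 ≤ γ₀) (c : RPSChain μ γ₀) (n k : ℕ) (hk : n ≤ k) (h : Ω → ℝ) (hw : c.Wt n h)
    (U : Ω → ℝ) (hU : U = c.MM k ∨ U = fun ω => 1/27 - c.MM k ω + 1/rpsGamma γ₀ k) :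
    ∫ ω, h ω * (c.MM (k+1) ω - c.MM n ω)^2 ∂μ ≤
      ∫ ω, h ω * (c.MM k ω - c.MM n ω)^2 ∂μ + 7000/(rpsGamma γ₀ k+4)^2 * ∫ ω, h ω * U ω ∂μ := by
  have hUi : Integrable (fun ω => h ω * U ω) μ := by
    rcases hU with rfl | rfl
    · exact hw.intM k
    · have := ((hw.int1.const_mul (1/27 + 1/rpsGamma γ₀ k)).sub (hw.intM k))
      refine this.congr (ae_of_all _ fun ω => ?_)
      simp only [Pi.sub_apply]; ring
  have hwk := hw.mono hk
  obtain ⟨h1, h2, K, hK⟩ := hwk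
  have mMn : Measurable[c.F k] (c.MM n) := (c.mMM n).mono (c.F.mono hk) le_rfl
  obtain ⟨-, i2, e⟩ := c.step_int hγ k (fun i ω => h ω * (c.TMc k i ω - c.MM n ω)^2)
    (fun i => h1.mul (((c.mTMc k i).sub mMn).pow_const 2)) K (by
      intro i
      filter_upwards [hK] with ω a
      rw [abs_of_nonneg (mul_nonneg (h2 ω) (sq_nonneg _))]
      have := c.TMc_le hγ k i ω
      have := c.TMc_nonneg hγ k i ω
      have := c.MM_le n ω
      have := c.MM_nonneg n ω
      have : (c.TMc k i ω - c.MM n ω)^2 ≤ 1 := by nlinarith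
      nlinarith [h2 ω]) (fun ω => h ω * (c.MM (k+1) ω - c.MM n ω)^2)
    (ae_of_all _ fun ω i hi => by simp only [TMc]; rw [c.MM_succ k i ω hi])
  rw [e, ← integral_const_mul, ← integral_add (hw.intQ k n) (hUi.const_mul _)]
  apply integral_mono i2 ((hw.intQ k n).add (hUi.const_mul _))
  intro ω
  have := L2 (gam_ge hγ k) (c.nonneg_X k ω) (c.nonneg_Y k ω) (c.nonneg_Z k ω) (c.sum_eq_one k ω)
    (c.MM_nonneg n ω) (c.MM_le n ω)
  have e1 : ∑ i, c.pr k i ω * (h ω * (c.TMc k i ω - c.MM n ω)^2)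
    = h ω * ∑ i, c.pr k i ω * (c.TMc k i ω - c.MM n ω)^2 := by
        rw [Finset.mul_sum]; congr 1; ext i; ring
  dsimp only [Pi.add_apply]
  rw [e1]
  have e2 : ∑ i, c.pr k i ω * (c.TMc k i ω - c.MM n ω)^2 ≤
     (c.MM k ω - c.MM n ω)^2 + 7000/(rpsGamma γ₀ k+4)^2*U ω := by
    rcases hU with rfl | rfl
    · refine this.1.trans (le_of_eq ?_)
      simp only [MM]; ring
    · refine this.2.trans (le_of_eq ?_)
      simp only [MM]; ring
  calc _ ≤ h ω * ((c.MM k ω - c.MM n ω)^2 + 7000/(rpsGamma γ₀ k+4)^2*U ω) :=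
        mul_le_mul_of_nonneg_left e2 (h2 ω)
    _ = _ := by ring

lemma Q_bound (hγ : 2 ≤ γ₀) (c : RPSChain μ γ₀) (n : ℕ) (h : Ω → ℝ) (hw : c.Wt n h)
    (U : ℕ → Ω → ℝ) (hU : U = c.MM ∨ U = fun k ω => 1/27 - c.MM k ω + 1/rpsGamma γ₀ k)
    (k : ℕ) (hk : n ≤ k) :
    ∫ ω, h ω * (c.MM k ω - c.MM n ω)^2 ∂μ ≤ 3500/rpsGamma γ₀ n * ∫ ω, h ω * U n ω ∂μ := by
  have gpos : ∀ k, 0 < rpsGamma γ₀ k := fun k => by linarith [gam_ge hγ k]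
  have hU0 : 0 ≤ ∫ ω, h ω * U n ω ∂μ := by
    apply integral_nonneg
    intro ω
    refine mul_nonneg (hw.2.1 ω) ?_
    rcases hU with rfl | rfl
    · exact c.MM_nonneg n ω
    · have := c.MM_le n ω
      have := gpos n
      have : 0 ≤ 1/rpsGamma γ₀ n := by positivity
      dsimp only; linarith
  have hU2 : ∀ k, n ≤ k → ∫ ω, h ω * U k ω ∂μ ≤ 2*∫ ω, h ω * U n ω ∂μ := by
    intro k hk
    rcases hU with rfl | rfl
    · have := c.M_decr hγ n h hw k hk
      linarith
    · have ex : ∀ k, ∫ ω, h ω * (1/27 - c.MM k ω + 1/rpsGamma γ₀ k) ∂μ =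
         (1/27+1/rpsGamma γ₀ k)*∫ ω, h ω ∂μ - ∫ ω, h ω * c.MM k ω ∂μ := by
        intro k
        rw [← integral_const_mul, ← integral_sub (hw.int1.const_mul _) (hw.intM k)]
        congr 1; ext ω; ring
      simp only [ex] at hU0 ⊢
      have h1 := c.M_incr hγ n h hw k hk
      have h4 : ∫ ω, h ω * c.MM n ω ∂μ ≤ 1/27*∫ ω, h ω ∂μ := by
        rw [← integral_const_mul]
        apply integral_mono (hw.intM n) (hw.int1.const_mul _)
        intro ω
        have := c.MM_le n ω
        have := hw.2.1 ω
        dsimp only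
        nlinarith
      nlinarith
  have main : ∫ ω, h ω * (c.MM k ω - c.MM n ω)^2 ∂μ ≤
      3500*(1/rpsGamma γ₀ n - 1/rpsGamma γ₀ k) * ∫ ω, h ω * U n ω ∂μ := by
    induction k, hk using Nat.le_induction with
    | base => simp
    | succ k hk ih =>
      have h1 := c.Q_step hγ n k hk h hw (U k) (by
        rcases hU with rfl | rfl
        · left; rfl
        · right; rfl)
      have h2 := hU2 k hk
      have h3 := gam_tel hγ k
      have : 7000/(rpsGamma γ₀ k+4)^2 = 7000*(1/(rpsGamma γ₀ k+4)^2) := by ring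
      rw [this] at h1
      have gp := gpos k
      have h4 : 7000*(1/(rpsGamma γ₀ k+4)^2) * ∫ ω, h ω * U k ω ∂μ ≤
        7000*(1/(rpsGamma γ₀ k+4)^2) * (2*∫ ω, h ω * U n ω ∂μ) := by gcongr
      have h5 : 7000*(1/(rpsGamma γ₀ k+4)^2) * (2*∫ ω, h ω * U n ω ∂μ) ≤
        7000*((1/rpsGamma γ₀ k - 1/rpsGamma γ₀ (k+1))/4) * (2*∫ ω, h ω * U n ω ∂μ) := by gcongr
      nlinarith
  refine main.trans ?_
  have : 3500*(1/rpsGamma γ₀ n - 1/rpsGamma γ₀ k) ≤ 3500/rpsGamma γ₀ n := by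
    have : 0 ≤ 1/rpsGamma γ₀ k := by have := gpos k; positivity
    have : 3500/rpsGamma γ₀ n = 3500*(1/rpsGamma γ₀ n) := by ring
    linarith
  gcongr

end RPSChain

set_option linter.unusedSectionVars false
namespace RPSChain
variable {Ω : Type*} [MeasurableSpace Ω] {μ : Measure Ω} {γ₀ : ℝ}
variable [IsProbabilityMeasure μ]

lemma wt_ind (c : RPSChain μ γ₀) (n : ℕ) {s : Set Ω} (hs : MeasurableSet[c.F n] s) :
    c.Wt n (s.indicator fun _ => (1:ℝ)) := by
  refine ⟨measurable_const.indicator hs, fun ω => indicator_nonneg (fun _ _ => zero_le_one) _, 1, ?_⟩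
  refine ae_of_all _ fun ω => ?_
  by_cases h : ω ∈ s <;> simp [h]

lemma int_ind {s : Set Ω} (hs : MeasurableSet s) (f : Ω → ℝ) :
    ∫ ω, s.indicator (fun _ => (1:ℝ)) ω * f ω ∂μ = ∫ ω in s, f ω ∂μ := by
  rw [← integral_indicator hs]
  congr 1
  ext ω
  by_cases h : ω ∈ s <;> simp [h]

lemma M_super (hγ : 2 ≤ γ₀) (c : RPSChain μ γ₀) : Supermartingale c.MM c.F μ := by
  refine supermartingale_of_setIntegral_succ_le (fun n => (c.mMM n).stronglyMeasurable) ?_ ?_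
  · intro n
    exact int_of_bdd (K := 1) (c.mMM' n).aemeasurable (ae_of_all _ (c.MM_abs n))
  · intro n s hs
    rw [← int_ind (c.F.le n s hs), ← int_ind (c.F.le n s hs)]
    exact c.M_decr hγ n _ (c.wt_ind n hs) (n+1) (by omega)

lemma exists_lim (hγ : 2 ≤ γ₀) (c : RPSChain μ γ₀) : ∃ L : Ω → ℝ,
    StronglyMeasurable[⨆ n, c.F n] L ∧ (∀ ω, 0 ≤ L ω ∧ L ω ≤ 1/27) ∧
    ∀ᵐ ω ∂μ, Tendsto (fun n => c.MM n ω) atTop (𝓝 (L ω)) := by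
  have h := (c.M_super hγ).neg
  have h2 := h.exists_ae_tendsto_of_bdd (R := 1) (by
    intro n
    refine (eLpNorm_le_of_ae_bound (C := 1) (ae_of_all _ fun ω => ?_)).trans ?_
    · simpa using c.MM_abs n ω
    · simp)
  obtain ⟨l, hl⟩ : ∃ l : Ω → ℝ, l = fun ω => -limsup (fun n => c.MM n ω) atTop := ⟨_, rfl⟩
  have hlm : StronglyMeasurable[⨆ n, c.F n] l := by
    rw [hl]
    refine Measurable.stronglyMeasurable ?_
    refine Measurable.neg ?_
    exact Measurable.limsup (fun i => (c.mMM i).mono (le_iSup (fun n => (c.F n : MeasurableSpace Ω)) i) le_rfl)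
  refine ⟨fun ω => max 0 (min (1/27) (-l ω)), ?_, ?_, ?_⟩
  · exact (by fun_prop : Continuous fun t : ℝ => max 0 (min (1/27) (-t))).comp_stronglyMeasurable hlm
  · intro ω
    refine ⟨le_max_left _ _, max_le (by norm_num) (min_le_left _ _)⟩
  · filter_upwards [h2] with ω ⟨t, hω⟩
    have h3 : Tendsto (fun n => c.MM n ω) atTop (𝓝 (-l ω)) := by
      have h5 : Tendsto (fun n => c.MM n ω) atTop (𝓝 (-t)) := by
        have := hω.neg
        simpa using this
      have h6 : -l ω = -t := by
        rw [hl]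
        simp only [neg_neg]
        exact h5.limsup_eq
      rw [h6]; exact h5
    have a := ge_of_tendsto' h3 (fun n => c.MM_nonneg n ω)
    have b := le_of_tendsto' h3 (fun n => c.MM_le n ω)
    rwa [min_eq_right b, max_eq_right a]

lemma gam_tendsto (γ₀ : ℝ) : Tendsto (rpsGamma γ₀) atTop atTop := by
  unfold rpsGamma
  exact tendsto_atTop_add_const_left _ _
    (tendsto_natCast_atTop_atTop.const_mul_atTop (by norm_num))

lemma gam_inv (γ₀ : ℝ) : Tendsto (fun n => 1/rpsGamma γ₀ n) atTop (𝓝 0) := by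
  simp only [one_div]
  exact (gam_tendsto γ₀).inv_tendsto_atTop

/-- the data of a limit -/
def IsLim (c : RPSChain μ γ₀) (L : Ω → ℝ) : Prop :=
  StronglyMeasurable[⨆ n, c.F n] L ∧ (∀ ω, 0 ≤ L ω ∧ L ω ≤ 1/27) ∧
    ∀ᵐ ω ∂μ, Tendsto (fun n => c.MM n ω) atTop (𝓝 (L ω))

lemma IsLim.meas {c : RPSChain μ γ₀} {L : Ω → ℝ} (hL : c.IsLim L) : Measurable L :=
  (hL.1.mono (iSup_le c.F.le)).measurable

lemma IsLim.intQ {c : RPSChain μ γ₀} {L : Ω → ℝ} (hL : c.IsLim L) {n : ℕ} {h : Ω → ℝ}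
    (hw : c.Wt n h) (k : ℕ) : Integrable (fun ω => h ω * (L ω - c.MM k ω)^2) μ := by
  refine hw.int ((hL.meas.sub (c.mMM' k)).pow_const 2).aemeasurable 1 (ae_of_all _ fun ω => ?_)
  rw [abs_of_nonneg (sq_nonneg _)]
  have := c.MM_nonneg k ω
  have := c.MM_le k ω
  have := hL.2.1 ω
  nlinarith

lemma IsLim.intL {c : RPSChain μ γ₀} {L : Ω → ℝ} (hL : c.IsLim L) {n : ℕ} {h : Ω → ℝ}
    (hw : c.Wt n h) : Integrable (fun ω => h ω * L ω) μ := by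
  refine hw.int hL.meas.aemeasurable 1 (ae_of_all _ fun ω => ?_)
  have := hL.2.1 ω
  rw [abs_of_nonneg this.1]
  linarith

lemma IsLim.bound {c : RPSChain μ γ₀} {L : Ω → ℝ} (hγ : 2 ≤ γ₀) (hL : c.IsLim L) (n : ℕ)
    (h : Ω → ℝ) (hw : c.Wt n h) (U : ℕ → Ω → ℝ)
    (hU : U = c.MM ∨ U = fun k ω => 1/27 - c.MM k ω + 1/rpsGamma γ₀ k) :
    ∫ ω, h ω * (L ω - c.MM n ω)^2 ∂μ ≤ 3500/rpsGamma γ₀ n * ∫ ω, h ω * U n ω ∂μ := by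
  have t : Tendsto (fun k => ∫ ω, h ω * (c.MM k ω - c.MM n ω)^2 ∂μ) atTop
      (𝓝 (∫ ω, h ω * (L ω - c.MM n ω)^2 ∂μ)) := by
    refine tendsto_integral_of_dominated_convergence h (fun k => (hw.intQ k n).1) hw.int1 ?_ ?_
    · intro k
      refine ae_of_all _ fun ω => ?_
      have h0 := hw.2.1 ω
      rw [Real.norm_eq_abs, abs_of_nonneg (by positivity)]
      exact mul_le_of_le_one_right h0 (c.MM_sub_sq n k ω)
    · filter_upwards [hL.2.2] with ω hω
      exact ((hω.sub_const _).pow 2).const_mul _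
  exact le_of_tendsto t ((eventually_ge_atTop n).mono fun k hk => c.Q_bound hγ n h hw U hU k hk)

lemma IsLim.decr {c : RPSChain μ γ₀} {L : Ω → ℝ} (hγ : 2 ≤ γ₀) (hL : c.IsLim L) (n : ℕ)
    (h : Ω → ℝ) (hw : c.Wt n h) :
    ∫ ω, h ω * L ω ∂μ ≤ (1-1/rpsGamma γ₀ n)*∫ ω, h ω * c.MM n ω ∂μ := by
  have t : Tendsto (fun k => ∫ ω, h ω * c.MM k ω ∂μ) atTop
      (𝓝 (∫ ω, h ω * L ω ∂μ)) := by
    refine tendsto_integral_of_dominated_convergence h (fun k => (hw.intM k).1) hw.int1 ?_ ?_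
    · intro k
      refine ae_of_all _ fun ω => ?_
      have h0 := hw.2.1 ω
      rw [Real.norm_eq_abs, abs_mul, abs_of_nonneg h0]
      exact mul_le_of_le_one_right h0 (c.MM_abs k ω)
    · filter_upwards [hL.2.2] with ω hω
      exact hω.const_mul _
  have t2 := ((gam_inv γ₀).const_sub 1).mul t
  rw [sub_zero, one_mul] at t2
  exact le_of_tendsto t2 ((eventually_ge_atTop n).mono fun k hk => c.M_decr2 hγ n h hw k hk)

end RPSChain

set_option linter.unusedSectionVars false
namespace RPSChain
variable {Ω : Type*} [MeasurableSpace Ω] {μ : Measure Ω} {γ₀ : ℝ}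
variable [IsProbabilityMeasure μ]

lemma sum_gam (hγ : 2 ≤ γ₀) (m : ℕ) :
    Tendsto (fun n => ∑ k ∈ Finset.range n, 1/rpsGamma γ₀ (k+m)) atTop atTop := by
  rw [← not_summable_iff_tendsto_nat_atTop_of_nonneg]
  · intro hs
    rw [summable_nat_add_iff (f := fun k => 1/rpsGamma γ₀ k)] at hs
    rw [← summable_nat_add_iff 1] at hs
    apply Real.not_summable_one_div_natCast
    rw [← summable_nat_add_iff 1]
    refine Summable.of_nonneg_of_le (fun n => by positivity) ?_ (hs.mul_left (γ₀+4))
    intro n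
    have : (0:ℝ) < ((n+1:ℕ):ℝ) := by positivity
    have h2 : 0 < rpsGamma γ₀ (n+1) := by linarith [gam_ge hγ (n+1)]
    rw [mul_one_div, div_le_div_iff₀ this h2, one_mul]
    unfold rpsGamma
    push_cast at *
    nlinarith
  · intro n
    have h2 : 0 < rpsGamma γ₀ (n+m) := by linarith [gam_ge hγ (n+m)]
    positivity

lemma contr_tendsto (hγ : 2 ≤ γ₀) {v : ℕ → ℝ} (hv : ∀ n, 0 ≤ v n) {κ : ℝ} (hκ : 0 < κ) (m : ℕ)
    (h : ∀ n, m ≤ n → v (n+1) ≤ (1 - κ/rpsGamma γ₀ n) * v n) : Tendsto v atTop (𝓝 0) := by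
  rw [← tendsto_add_atTop_iff_nat m]
  have key : ∀ n, v (n+m) ≤ Real.exp (-(κ * ∑ k ∈ Finset.range n, 1/rpsGamma γ₀ (k+m))) * v m := by
    intro n
    induction n with
    | zero => simp
    | succ n ih =>
      have h1 := h (n+m) (by omega)
      have h2 : 1 - κ/rpsGamma γ₀ (n+m) ≤ Real.exp (-(κ*(1/rpsGamma γ₀ (n+m)))) := by
        have := Real.add_one_le_exp (-(κ*(1/rpsGamma γ₀ (n+m))))
        rw [mul_one_div] at *
        linarith
      rw [show n+1+m = n+m+1 by ring, Finset.sum_range_succ, mul_add, neg_add, Real.exp_add]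
      calc v (n+m+1) ≤ _ := h1
        _ ≤ Real.exp (-(κ*(1/rpsGamma γ₀ (n+m)))) * v (n+m) := by
            gcongr; exact hv _
        _ ≤ Real.exp (-(κ*(1/rpsGamma γ₀ (n+m)))) * (Real.exp (-(κ * ∑ k ∈ Finset.range n, 1/rpsGamma γ₀ (k+m))) * v m) := by
            gcongr
        _ = _ := by ring
  refine squeeze_zero (fun n => hv _) key ?_
  have := (Real.tendsto_exp_neg_atTop_nhds_zero.comp
    ((sum_gam hγ m).const_mul_atTop hκ)).mul_const (v m)
  simpa [Function.comp_def] using this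

lemma deg_succ (hγ : 2 ≤ γ₀) (c : RPSChain μ γ₀) {n : ℕ} {i : Fin 6} {ω : Ω} (h : ω ∈ c.Ev n i) :
    rpsGamma γ₀ (n+1) * c.X (n+1) ω = rpsGamma γ₀ n * c.X n ω + (rpsIncr i).1 ∧
    rpsGamma γ₀ (n+1) * c.Y (n+1) ω = rpsGamma γ₀ n * c.Y n ω + (rpsIncr i).2.1 ∧
    rpsGamma γ₀ (n+1) * c.Z (n+1) ω = rpsGamma γ₀ n * c.Z n ω + (rpsIncr i).2.2 := by
  obtain ⟨h1, h2, h3⟩ := h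
  have : rpsGamma γ₀ (n+1) ≠ 0 := by linarith [gam_ge hγ (n+1)]
  rw [h1, h2, h3]
  refine ⟨?_, ?_, ?_⟩ <;> field_simp

lemma deg_mono (hγ : 2 ≤ γ₀) (c : RPSChain μ γ₀) {ω : Ω} (hω : ∀ n, ∃ i, ω ∈ c.Ev n i) {n k : ℕ}
    (hk : n ≤ k) :
    rpsGamma γ₀ n * c.X n ω ≤ rpsGamma γ₀ k * c.X k ω ∧
    rpsGamma γ₀ n * c.Y n ω ≤ rpsGamma γ₀ k * c.Y k ω ∧
    rpsGamma γ₀ n * c.Z n ω ≤ rpsGamma γ₀ k * c.Z k ω := by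
  induction k, hk using Nat.le_induction with
  | base => exact ⟨le_rfl, le_rfl, le_rfl⟩
  | succ k hk ih =>
    obtain ⟨i, hi⟩ := hω k
    obtain ⟨a, b, e⟩ := c.deg_succ hγ hi
    obtain ⟨p, q, r, -⟩ := rpsIncr_nonneg i
    refine ⟨by linarith, by linarith, by linarith⟩

/-- all degrees at least `d` -/
def Dg (c : RPSChain μ γ₀) (d : ℝ) (n : ℕ) : Set Ω :=
  {ω | d ≤ rpsGamma γ₀ n * c.X n ω ∧ d ≤ rpsGamma γ₀ n * c.Y n ω ∧ d ≤ rpsGamma γ₀ n * c.Z n ω}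

lemma mDg (c : RPSChain μ γ₀) (d : ℝ) (n : ℕ) : MeasurableSet[c.F n] (c.Dg d n) := by
  have h1 := c.mX n
  have h2 := c.mY n
  have h3 := c.mZ n
  have a : MeasurableSet[c.F n] {ω | d ≤ rpsGamma γ₀ n * c.X n ω} :=
    (h1.const_mul (rpsGamma γ₀ n)) measurableSet_Ici
  have b : MeasurableSet[c.F n] {ω | d ≤ rpsGamma γ₀ n * c.Y n ω} :=
    (h2.const_mul (rpsGamma γ₀ n)) measurableSet_Ici
  have e : MeasurableSet[c.F n] {ω | d ≤ rpsGamma γ₀ n * c.Z n ω} :=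
    (h3.const_mul (rpsGamma γ₀ n)) measurableSet_Ici
  exact @MeasurableSet.inter _ (c.F n) _ _ a (@MeasurableSet.inter _ (c.F n) _ _ b e)

lemma exists_d (hγ : 2 ≤ γ₀) (c : RPSChain μ γ₀) : ∃ d > 0, ∀ᵐ ω ∂μ, ∀ n, ω ∈ c.Dg d n := by
  have hne : Nonempty Ω := nonempty_of_isProbabilityMeasure μ
  obtain ⟨ω₀⟩ := hne
  have hg : 0 < rpsGamma γ₀ 0 := by linarith [gam_ge hγ 0]
  refine ⟨rpsGamma γ₀ 0 * min (c.X 0 ω₀) (min (c.Y 0 ω₀) (c.Z 0 ω₀)),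
    mul_pos hg (lt_min (c.init_X_pos _) (lt_min (c.init_Y_pos _) (c.init_Z_pos _))), ?_⟩
  filter_upwards [c.ae_step hγ] with ω hω n
  obtain ⟨h1, h2, h3⟩ := c.deg_mono hγ hω (Nat.zero_le n)
  rw [c.init_X_const ω ω₀] at h1
  rw [c.init_Y_const ω ω₀] at h2
  rw [c.init_Z_const ω ω₀] at h3
  refine ⟨le_trans ?_ h1, le_trans ?_ h2, le_trans ?_ h3⟩
  · gcongr; exact min_le_left _ _
  · gcongr; exact (min_le_right _ _).trans (min_le_left _ _)
  · gcongr; exact (min_le_right _ _).trans (min_le_right _ _)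

lemma Dg_pos (hγ : 2 ≤ γ₀) (c : RPSChain μ γ₀) {d : ℝ} (hd : 0 < d) {n : ℕ} {ω : Ω}
    (h : ω ∈ c.Dg d n) : 0 < c.X n ω ∧ 0 < c.Y n ω ∧ 0 < c.Z n ω ∧ 0 < c.MM n ω ∧
      d^3/rpsGamma γ₀ n^3 ≤ c.MM n ω := by
  have hg : 0 < rpsGamma γ₀ n := by linarith [gam_ge hγ n]
  obtain ⟨h1, h2, h3⟩ := h
  have p : ∀ t, d ≤ rpsGamma γ₀ n * t → 0 < t := fun t ht => by
    by_contra hc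
    nlinarith
  have a := p _ h1
  have b := p _ h2
  have e := p _ h3
  refine ⟨a, b, e, mul_pos (mul_pos a b) e, ?_⟩
  rw [div_le_iff₀ (by positivity)]
  unfold MM
  calc d^3 = d*d*d := by ring
    _ ≤ (rpsGamma γ₀ n * c.X n ω)*(rpsGamma γ₀ n * c.Y n ω)*(rpsGamma γ₀ n * c.Z n ω) := by
      gcongr
    _ = _ := by ring

/-- reciprocal degrees -/
def V (c : RPSChain μ γ₀) (n : ℕ) (ω : Ω) : ℝ :=
  1/(rpsGamma γ₀ n * c.X n ω) + 1/(rpsGamma γ₀ n * c.Y n ω) + 1/(rpsGamma γ₀ n * c.Z n ω)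

lemma V_nonneg (hγ : 2 ≤ γ₀) (c : RPSChain μ γ₀) (n : ℕ) (ω : Ω) : 0 ≤ c.V n ω := by
  have := gam_ge hγ n
  have := c.nonneg_X n ω
  have := c.nonneg_Y n ω
  have := c.nonneg_Z n ω
  unfold V
  positivity

lemma V_step (hγ : 2 ≤ γ₀) (c : RPSChain μ γ₀) {d : ℝ} (hd : 0 < d)
    (hD : ∀ᵐ ω ∂μ, ∀ n, ω ∈ c.Dg d n) (n : ℕ) :
    Integrable (c.V (n+1)) μ ∧ (Integrable (c.V n) μ → 
    ∫ ω, c.V (n+1) ω ∂μ ≤ (1 - d/(d+1)/rpsGamma γ₀ n) * ∫ ω, c.V n ω ∂μ) := by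
  have hg : 2 ≤ rpsGamma γ₀ n := gam_ge hγ n
  have h1 := c.mX n
  have h2 := c.mY n
  have h3 := c.mZ n
  obtain ⟨a, b, e⟩ := c.step_int hγ n (fun i ω => 1/(rpsGamma γ₀ n * c.X n ω+(rpsIncr i).1)
    + 1/(rpsGamma γ₀ n * c.Y n ω+(rpsIncr i).2.1) + 1/(rpsGamma γ₀ n * c.Z n ω+(rpsIncr i).2.2))
    (fun i => by fun_prop) (1/d+1/d+1/d) (by
      intro i
      filter_upwards [hD] with ω hω
      obtain ⟨p, q, r, -⟩ := rpsIncr_nonneg i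
      obtain ⟨u, v, w⟩ := hω n
      have u' : d ≤ rpsGamma γ₀ n * c.X n ω+(rpsIncr i).1 := by linarith
      have v' : d ≤ rpsGamma γ₀ n * c.Y n ω+(rpsIncr i).2.1 := by linarith
      have w' : d ≤ rpsGamma γ₀ n * c.Z n ω+(rpsIncr i).2.2 := by linarith
      have : 0 < rpsGamma γ₀ n * c.X n ω+(rpsIncr i).1 := by linarith
      have : 0 < rpsGamma γ₀ n * c.Y n ω+(rpsIncr i).2.1 := by linarith
      have : 0 < rpsGamma γ₀ n * c.Z n ω+(rpsIncr i).2.2 := by linarith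
      rw [abs_of_nonneg (by positivity)]
      gcongr) (c.V (n+1)) (ae_of_all _ fun ω i hi => by
      obtain ⟨p, q, r⟩ := c.deg_succ hγ hi
      simp only [V]
      rw [p, q, r])
  refine ⟨a, fun hV => ?_⟩
  rw [e, ← integral_const_mul]
  refine integral_mono_ae b (hV.const_mul _) ?_
  filter_upwards [hD] with ω hω
  obtain ⟨u, v, w⟩ := hω n
  exact L3 hg hd u v w (c.sum_eq_one n ω)

lemma V_tendsto (hγ : 2 ≤ γ₀) (c : RPSChain μ γ₀) :
    (∀ n, Integrable (c.V (n+1)) μ) ∧ Tendsto (fun n => ∫ ω, c.V n ω ∂μ) atTop (𝓝 0) := by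
  obtain ⟨d, hd, hD⟩ := c.exists_d hγ
  refine ⟨fun n => (c.V_step hγ hd hD n).1, ?_⟩
  refine contr_tendsto hγ (fun n => integral_nonneg fun ω => c.V_nonneg hγ n ω)
    (κ := d/(d+1)) (by positivity) 1 ?_
  intro n hn
  obtain ⟨m, rfl⟩ : ∃ m, n = m+1 := ⟨n-1, by omega⟩
  exact (c.V_step hγ hd hD _).2 (c.V_step hγ hd hD _).1

lemma Dg_small (hγ : 2 ≤ γ₀) (c : RPSChain μ γ₀) {ε : ℝ} (hε : 0 < ε) :
    ∃ n, μ.real (c.Dg 81 n)ᶜ < ε := by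
  obtain ⟨hi, ht⟩ := c.V_tendsto hγ
  obtain ⟨d, hd, hD⟩ := c.exists_d hγ
  have := (((tendsto_add_atTop_iff_nat 1).2 ht).eventually (gt_mem_nhds (show 0 < ε/81 by positivity))).exists
  obtain ⟨n, hn⟩ := this
  refine ⟨n+1, ?_⟩
  have hm : MeasurableSet (c.Dg 81 (n+1)) := c.F.le _ _ (c.mDg 81 (n+1))
  have h1 : μ.real (c.Dg 81 (n+1))ᶜ = ∫ ω, (c.Dg 81 (n+1))ᶜ.indicator (fun _ => (1:ℝ)) ω ∂μ := by
    rw [integral_indicator_const _ hm.compl]; simp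
  rw [h1]
  have : ∫ ω, (c.Dg 81 (n+1))ᶜ.indicator (fun _ => (1:ℝ)) ω ∂μ ≤ ∫ ω, 81 * c.V (n+1) ω ∂μ := by
    refine integral_mono_ae ((integrable_const _).indicator hm.compl) ((hi n).const_mul _) ?_
    filter_upwards [hD] with ω hω
    by_cases hG : ω ∈ c.Dg 81 (n+1)
    · simp [hG, c.V_nonneg hγ (n+1) ω]
    · rw [indicator_of_mem (by exact hG)]
      have hg := gam_ge hγ (n+1)
      obtain ⟨a, b, e, -⟩ := c.Dg_pos hγ hd (hω (n+1))
      have q : ∀ t : ℝ, 0 < t → t < 81 → 1/81 < 1/t := fun t h h' => one_div_lt_one_div_of_lt h h'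
      have pa : 0 < rpsGamma γ₀ (n+1) * c.X (n+1) ω := by positivity
      have pb : 0 < rpsGamma γ₀ (n+1) * c.Y (n+1) ω := by positivity
      have pe : 0 < rpsGamma γ₀ (n+1) * c.Z (n+1) ω := by positivity
      have pa' := one_div_pos.2 pa
      have pb' := one_div_pos.2 pb
      have pe' := one_div_pos.2 pe
      simp only [Dg, mem_setOf_eq, not_and_or, not_le] at hG
      simp only [V]
      rcases hG with h | h | h
      · have := q _ pa h; linarith
      · have := q _ pb h; linarith
      · have := q _ pe h; linarith
  rw [integral_const_mul] at this
  linarith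

/-- localised reciprocal of `γ M` -/
def S (c : RPSChain μ γ₀) (G : Set Ω) (n : ℕ) (ω : Ω) : ℝ :=
  G.indicator (fun _ => (1:ℝ)) ω * (1/(rpsGamma γ₀ n * c.MM n ω))

lemma S_nonneg (hγ : 2 ≤ γ₀) (c : RPSChain μ γ₀) (G : Set Ω) (n : ℕ) (ω : Ω) : 0 ≤ c.S G n ω := by
  have := gam_ge hγ n
  have := c.MM_nonneg n ω
  have : 0 ≤ G.indicator (fun _ => (1:ℝ)) ω := indicator_nonneg (fun _ _ => zero_le_one) _
  unfold S
  positivity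

lemma S_step (hγ : 2 ≤ γ₀) (c : RPSChain μ γ₀) (m n : ℕ) (hmn : m ≤ n) :
    Integrable (c.S (c.Dg 81 m) (n+1)) μ ∧ (Integrable (c.S (c.Dg 81 m) n) μ → 
    ∫ ω, c.S (c.Dg 81 m) (n+1) ω ∂μ ≤ (1 - 1/rpsGamma γ₀ n) * ∫ ω, c.S (c.Dg 81 m) n ω ∂μ) := by
  obtain ⟨d, hd, hD⟩ := c.exists_d hγ
  have hg : 2 ≤ rpsGamma γ₀ n := gam_ge hγ n
  have hw := (c.wt_ind m (c.mDg 81 m)).mono hmn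
  have i01 : ∀ ω, 0 ≤ (c.Dg 81 m).indicator (fun _ => (1:ℝ)) ω ∧
    (c.Dg 81 m).indicator (fun _ => (1:ℝ)) ω ≤ 1 := by
    intro ω
    by_cases h : ω ∈ c.Dg 81 m <;> simp [h]
  obtain ⟨a, b, e⟩ := c.step_int hγ n (fun i ω => (c.Dg 81 m).indicator (fun _ => (1:ℝ)) ω *
      (1/((rpsGamma γ₀ n + 4) * c.TMc n i ω)))
    (fun i => by
      have h1 := c.mTMc n i
      have h2 := hw.1
      refine h2.mul ?_
      fun_prop) (1/((rpsGamma γ₀ n + 4) * (d/(rpsGamma γ₀ n + 4)*(d/(rpsGamma γ₀ n + 4))*(d/(rpsGamma γ₀ n + 4))))) (by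
      intro i
      filter_upwards [hD] with ω hω
      obtain ⟨p, q, r, -⟩ := rpsIncr_nonneg i
      obtain ⟨u, v, w⟩ := hω n
      have u' : d ≤ rpsGamma γ₀ n * c.X n ω+(rpsIncr i).1 := by linarith
      have v' : d ≤ rpsGamma γ₀ n * c.Y n ω+(rpsIncr i).2.1 := by linarith
      have w' : d ≤ rpsGamma γ₀ n * c.Z n ω+(rpsIncr i).2.2 := by linarith
      have T : d/(rpsGamma γ₀ n + 4)*(d/(rpsGamma γ₀ n + 4))*(d/(rpsGamma γ₀ n + 4)) ≤ c.TMc n i ω := by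
        unfold TMc TM
        have : 0 < rpsGamma γ₀ n * c.X n ω+(rpsIncr i).1 := by linarith
        have : 0 < rpsGamma γ₀ n * c.Y n ω+(rpsIncr i).2.1 := by linarith
        have : 0 < rpsGamma γ₀ n * c.Z n ω+(rpsIncr i).2.2 := by linarith
        gcongr
      have T0 : 0 < d/(rpsGamma γ₀ n + 4)*(d/(rpsGamma γ₀ n + 4))*(d/(rpsGamma γ₀ n + 4)) := by
        positivity
      have T1 : 0 < c.TMc n i ω := by linarith
      rw [abs_mul, abs_of_nonneg (i01 ω).1, abs_of_nonneg (by positivity)]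
      refine (mul_le_of_le_one_left (by positivity) (i01 ω).2).trans ?_
      gcongr) (c.S (c.Dg 81 m) (n+1)) (ae_of_all _ fun ω i hi => by
      simp only [S]
      rw [c.MM_succ n i ω hi, gam_succ]
      rfl)
  refine ⟨a, fun hV => ?_⟩
  rw [e, ← integral_const_mul]
  refine integral_mono_ae b (hV.const_mul _) ?_
  filter_upwards [hD, c.ae_step hγ] with ω hω hs
  by_cases hG : ω ∈ c.Dg 81 m
  · obtain ⟨u, v, w⟩ := hG
    obtain ⟨u', v', w'⟩ := c.deg_mono hγ hs hmn
    have := L4 (u.trans u') (v.trans v') (w.trans w') (c.sum_eq_one n ω)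
    have hG : ω ∈ c.Dg 81 m := ⟨u, v, w⟩
    simpa [S, hG, TMc, pr, MM] using this
  · simp [S, hG]

lemma S_tendsto (hγ : 2 ≤ γ₀) (c : RPSChain μ γ₀) (m : ℕ) :
    Tendsto (fun n => ∫ ω, c.S (c.Dg 81 m) n ω ∂μ) atTop (𝓝 0) := by
  refine contr_tendsto hγ (fun n => integral_nonneg fun ω => c.S_nonneg hγ _ n ω)
    (κ := 1) (by positivity) (m+1) ?_
  intro n hn
  obtain ⟨k, rfl⟩ : ∃ k, n = k+1 := ⟨n-1, by omega⟩
  exact (c.S_step hγ m _ (by omega)).2 (c.S_step hγ m _ (by omega)).1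

lemma IsLim.zero_G {c : RPSChain μ γ₀} {L : Ω → ℝ} (hγ : 2 ≤ γ₀) (hL : c.IsLim L) (m n : ℕ)
    (hmn : m ≤ n) : μ.real ({ω | L ω = 0} ∩ c.Dg 81 m) ≤ 3500 * ∫ ω, c.S (c.Dg 81 m) n ω ∂μ := by
  obtain ⟨d, hd, hD⟩ := c.exists_d hγ
  have hg : 2 ≤ rpsGamma γ₀ n := gam_ge hγ n
  have hw0 := (c.wt_ind m (c.mDg 81 m)).mono hmn
  have i01 : ∀ ω, 0 ≤ (c.Dg 81 m).indicator (fun _ => (1:ℝ)) ω ∧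
    (c.Dg 81 m).indicator (fun _ => (1:ℝ)) ω ≤ 1 := by
    intro ω
    by_cases h : ω ∈ c.Dg 81 m <;> simp [h]
  have hw : c.Wt n (fun ω => (c.Dg 81 m).indicator (fun _ => (1:ℝ)) ω * (1/c.MM n ω^2)) := by
    refine ⟨hw0.1.mul ?_, fun ω => ?_, 1/(d^3/rpsGamma γ₀ n^3)^2, ?_⟩
    · have := c.mMM n
      fun_prop
    · have := (i01 ω).1
      have := c.MM_nonneg n ω
      positivity
    · filter_upwards [hD] with ω hω
      obtain ⟨-, -, -, p, q⟩ := c.Dg_pos hγ hd (hω n)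
      refine (mul_le_of_le_one_left (by positivity) (i01 ω).2).trans ?_
      gcongr
  have hb := hL.bound hγ n _ hw c.MM (Or.inl rfl)
  have hm : MeasurableSet ({ω | L ω = 0} ∩ c.Dg 81 m) :=
    (measurableSet_eq_fun hL.meas measurable_const).inter (c.F.le _ _ (c.mDg 81 m))
  have h1 : μ.real ({ω | L ω = 0} ∩ c.Dg 81 m) = 
      ∫ ω, ({ω | L ω = 0} ∩ c.Dg 81 m).indicator (fun _ => (1:ℝ)) ω ∂μ := by
    rw [integral_indicator_const _ hm]; simp
  rw [h1]
  refine le_trans (integral_mono_ae ((integrable_const _).indicator hm) (hL.intQ hw n) ?_)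
    (hb.trans (le_of_eq ?_))
  · filter_upwards [hD] with ω hω
    obtain ⟨-, -, -, p, q⟩ := c.Dg_pos hγ hd (hω n)
    by_cases hG : ω ∈ {ω | L ω = 0} ∩ c.Dg 81 m
    · have h1' : L ω = 0 := hG.1
      rw [indicator_of_mem hG, indicator_of_mem hG.2, h1']
      field_simp
      norm_num
    · rw [indicator_of_notMem hG]
      have := (i01 ω).1
      positivity
  · rw [← integral_const_mul, ← integral_const_mul]
    refine integral_congr_ae ?_
    filter_upwards [hD] with ω hω
    obtain ⟨-, -, -, p, q⟩ := c.Dg_pos hγ hd (hω n)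
    simp only [S]
    field_simp

lemma IsLim.pos {c : RPSChain μ γ₀} {L : Ω → ℝ} (hγ : 2 ≤ γ₀) (hL : c.IsLim L) :
    ∀ᵐ ω ∂μ, 0 < L ω := by
  have hz : μ.real {ω | L ω = 0} ≤ 0 := by
    refine le_of_forall_pos_lt_add fun ε hε => ?_
    obtain ⟨m, hm⟩ := c.Dg_small hγ hε
    have h2 : μ.real ({ω | L ω = 0} ∩ c.Dg 81 m) ≤ 0 := by
      have t := (c.S_tendsto hγ m).const_mul 3500
      rw [mul_zero] at t
      exact ge_of_tendsto t ((eventually_ge_atTop m).mono fun n hn => hL.zero_G hγ m n hn)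
    have h3 : μ.real {ω | L ω = 0} ≤ μ.real ({ω | L ω = 0} ∩ c.Dg 81 m) + μ.real (c.Dg 81 m)ᶜ := by
      refine le_trans (measureReal_mono ?_) (measureReal_union_le _ _)
      intro ω hω
      by_cases h : ω ∈ c.Dg 81 m
      · exact Or.inl ⟨hω, h⟩
      · exact Or.inr h
    linarith
  have h0 : μ {ω | L ω = 0} = 0 := by
    have := le_antisymm hz measureReal_nonneg
    rwa [measureReal_eq_zero_iff] at this
  have : ∀ᵐ ω ∂μ, L ω ≠ 0 := by
    rw [ae_iff]
    simpa using h0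
  filter_upwards [this] with ω h
  exact lt_of_le_of_ne (hL.2.1 ω).1 (Ne.symm h)

end RPSChain

set_option linter.unusedSectionVars false
namespace RPSChain
variable {Ω : Type*} [MeasurableSpace Ω] {μ : Measure Ω} {γ₀ : ℝ}
variable [IsProbabilityMeasure μ]

lemma IsLim.top_step {c : RPSChain μ γ₀} {L : Ω → ℝ} (hγ : 2 ≤ γ₀) (hL : c.IsLim L) (n : ℕ)
    {A : Set Ω} (hA : MeasurableSet[c.F n] A) :
    (1/27)^2/7002 * μ.real A ≤ μ.real (A ∩ {ω | L ω = 1/27}ᶜ) := by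
  have hg : 2 ≤ rpsGamma γ₀ n := gam_ge hγ n
  have hg0 : 0 < rpsGamma γ₀ n := by linarith
  have hA' := c.F.le _ _ hA
  have hw0 := c.wt_ind n hA
  set R : Ω → ℝ := fun ω => 1/27 - c.MM n ω + 1/rpsGamma γ₀ n with hR
  have R1 : ∀ ω, 1/rpsGamma γ₀ n ≤ R ω := fun ω => by
    have := c.MM_le n ω
    simp only [hR]; linarith
  have R0 : ∀ ω, 0 < R ω := fun ω => (one_div_pos.2 hg0).trans_le (R1 ω)
  have mR : Measurable[c.F n] R := by
    have := c.mMM n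
    simp only [hR]
    fun_prop
  set I : Ω → ℝ := A.indicator fun _ => (1:ℝ) with hI
  have i01 : ∀ ω, 0 ≤ I ω ∧ I ω ≤ 1 := by
    intro ω
    by_cases h : ω ∈ A <;> simp [hI, h]
  have wt : ∀ k : ℕ, c.Wt n (fun ω => I ω * (1/R ω^k)) := by
    intro k
    refine ⟨hw0.1.mul (by fun_prop), fun ω => ?_, 1/(1/rpsGamma γ₀ n)^k, ae_of_all _ fun ω => ?_⟩
    · have := R0 ω
      have := (i01 ω).1
      positivity
    · have := R0 ω
      refine (mul_le_of_le_one_left (by positivity) (i01 ω).2).trans ?_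
      have := R1 ω
      gcongr
  have w1 := wt 1
  have w2 := wt 2
  have iA : ∫ ω, I ω ∂μ = μ.real A := by
    rw [hI, integral_indicator_const _ hA']; simp
  have J1 : (1/27) * μ.real A ≤ ∫ ω, (I ω * (1/R ω^1)) * (1/27 - L ω) ∂μ := by
    have e1 : ∫ ω, (I ω * (1/R ω^1)) * (1/27 - L ω) ∂μ =
      ∫ ω, (I ω * (1/R ω^1)) * (1/27) ∂μ - ∫ ω, (I ω * (1/R ω^1)) * L ω ∂μ := by
      rw [← integral_sub (w1.int1.mul_const _) (hL.intL w1)]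
      congr 1; ext ω; ring
    have e2 := hL.decr hγ n _ w1
    have e3 : (1/27) * μ.real A ≤ ∫ ω, (I ω * (1/R ω^1)) * (1/27) ∂μ -
      (1-1/rpsGamma γ₀ n) * ∫ ω, (I ω * (1/R ω^1)) * c.MM n ω ∂μ := by
      rw [← integral_const_mul, ← integral_sub (w1.int1.mul_const _) ((w1.intM n).const_mul _),
        ← iA, ← integral_const_mul]
      refine integral_mono (hw0.int1.const_mul _) ((w1.int1.mul_const _).sub ((w1.intM n).const_mul _)) ?_
      intro ω
      have hr := R0 ω
      have q : 1/27 * R ω ≤ 1/27 - (1-1/rpsGamma γ₀ n) * c.MM n ω := by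
        have a := c.MM_le n ω
        have b : 1/rpsGamma γ₀ n ≤ 1/2 := one_div_le_one_div_of_le (by norm_num) hg
        have : 0 ≤ (1/27 - c.MM n ω) * (1 - 1/rpsGamma γ₀ n - 1/27) := by
          apply mul_nonneg <;> linarith
        simp only [hR]
        linarith
      calc 1/27 * I ω = I ω * (1/R ω^1) * (1/27 * R ω) := by field_simp
        _ ≤ I ω * (1/R ω^1) * (1/27 - (1-1/rpsGamma γ₀ n) * c.MM n ω) := by
          have := (i01 ω).1
          gcongr
        _ = _ := by simp only [Pi.sub_apply]; ring
    linarith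
  have mL2 : Integrable (fun ω => (I ω * (1/R ω^2)) * (1/27 - L ω)^2) μ := by
    refine w2.int ((hL.meas.const_sub _).pow_const 2).aemeasurable 1 (ae_of_all _ fun ω => ?_)
    have := hL.2.1 ω
    rw [abs_of_nonneg (sq_nonneg _)]
    nlinarith
  have mL1 : Integrable (fun ω => (I ω * (1/R ω^1)) * (1/27 - L ω)) μ := by
    refine w1.int (hL.meas.const_sub _).aemeasurable 1 (ae_of_all _ fun ω => ?_)
    have := hL.2.1 ω
    rw [abs_of_nonneg (by linarith)]
    linarith
  have mL3 : Integrable (fun ω => (I ω * (1/R ω^2)) * R ω) μ := by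
    refine w2.int (mR.mono (c.F.le n) le_rfl).aemeasurable 1 (ae_of_all _ fun ω => ?_)
    have b : 1/rpsGamma γ₀ n ≤ 1/2 := one_div_le_one_div_of_le (by norm_num) hg
    have := c.MM_nonneg n ω
    rw [abs_of_nonneg (R0 ω).le]
    simp only [hR]
    linarith
  have J2 : ∫ ω, (I ω * (1/R ω^2)) * (1/27 - L ω)^2 ∂μ ≤ 7002 * μ.real A := by
    have e1 := hL.bound hγ n _ w2 _ (Or.inr rfl)
    have e2 : 3500/rpsGamma γ₀ n * ∫ ω, (I ω * (1/R ω^2)) * R ω ∂μ ≤ 3500 * μ.real A := by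
      rw [← iA, ← integral_const_mul, ← integral_const_mul]
      refine integral_mono (mL3.const_mul _) (hw0.int1.const_mul _) ?_
      intro ω
      have hr := R0 ω
      calc 3500/rpsGamma γ₀ n * (I ω * (1/R ω^2) * R ω) = 3500 * (I ω * (1/R ω)) * (1/rpsGamma γ₀ n) := by
            field_simp
        _ ≤ 3500 * (I ω * (1/R ω)) * R ω := by
            have := (i01 ω).1
            have := R1 ω
            gcongr
        _ = 3500 * I ω := by field_simp
    have e3 : ∫ ω, (I ω * (1/R ω^2)) * (1/27 - L ω)^2 ∂μ ≤
        ∫ ω, (2 * I ω + 2 * ((I ω * (1/R ω^2)) * (L ω - c.MM n ω)^2)) ∂μ := by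
      refine integral_mono mL2 ((hw0.int1.const_mul _).add ((hL.intQ w2 n).const_mul _)) ?_
      intro ω
      have hr := R0 ω
      have q : (1/27 - L ω)^2 ≤ 2 * R ω^2 + 2 * (L ω - c.MM n ω)^2 := by
        have a := c.MM_le n ω
        have : (1/27 - c.MM n ω)^2 ≤ R ω^2 := by
          have : 0 < 1/rpsGamma γ₀ n := one_div_pos.2 hg0
          apply pow_le_pow_left₀ (by linarith)
          simp only [hR]; linarith
        nlinarith [sq_nonneg ((1/27 - c.MM n ω) + (L ω - c.MM n ω))]
      calc (I ω * (1/R ω^2)) * (1/27 - L ω)^2 ≤ (I ω * (1/R ω^2)) * (2 * R ω^2 + 2 * (L ω - c.MM n ω)^2) := by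
            have := (i01 ω).1
            gcongr
        _ = _ := by field_simp
    rw [integral_add (hw0.int1.const_mul _) ((hL.intQ w2 n).const_mul _), integral_const_mul,
      integral_const_mul] at e3
    rw [iA] at e3
    linarith
  have hm : MeasurableSet (A ∩ {ω | L ω = 1/27}ᶜ) :=
    hA'.inter (measurableSet_eq_fun hL.meas measurable_const).compl
  have h1 : μ.real (A ∩ {ω | L ω = 1/27}ᶜ) =
      ∫ ω, (A ∩ {ω | L ω = 1/27}ᶜ).indicator (fun _ => (1:ℝ)) ω ∂μ := by
    rw [integral_indicator_const _ hm]; simp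
  have J3 : ∫ ω, (2*(1/27/7002) * ((I ω * (1/R ω^1)) * (1/27 - L ω)) -
      (1/27/7002)^2 * ((I ω * (1/R ω^2)) * (1/27 - L ω)^2)) ∂μ ≤ μ.real (A ∩ {ω | L ω = 1/27}ᶜ) := by
    rw [h1]
    refine integral_mono ((mL1.const_mul _).sub (mL2.const_mul _)) ((integrable_const _).indicator hm) ?_
    intro ω
    have hr := R0 ω
    by_cases hG : ω ∈ A
    · by_cases hB : L ω = 1/27
      · simp [hB]
      · have : ω ∈ A ∩ {ω | L ω = 1/27}ᶜ := ⟨hG, hB⟩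
        simp only [hI]
        rw [indicator_of_mem this, indicator_of_mem hG]
        have e : 2*(1/27/7002) * (1 * (1/R ω^1) * (1/27 - L ω)) -
          (1/27/7002)^2 * (1 * (1/R ω^2) * (1/27 - L ω)^2) =
          1 - (1 - 1/27/7002 * (1/R ω) * (1/27 - L ω))^2 := by
          field_simp
          ring
        rw [e]
        linarith [sq_nonneg (1 - 1/27/7002 * (1/R ω) * (1/27 - L ω))]
    · have : ω ∉ A ∩ {ω | L ω = 1/27}ᶜ := fun h => hG h.1
      simp only [hI]
      rw [indicator_of_notMem this, indicator_of_notMem hG]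
      simp
  rw [integral_sub (mL1.const_mul _) (mL2.const_mul _), integral_const_mul, integral_const_mul] at J3
  nlinarith

lemma IsLim.lt {c : RPSChain μ γ₀} {L : Ω → ℝ} (hγ : 2 ≤ γ₀) (hL : c.IsLim L) :
    ∀ᵐ ω ∂μ, L ω < 1/27 := by
  set B : Set Ω := {ω | L ω = 1/27} with hB
  have hBm : MeasurableSet[⨆ n, c.F n] B := hL.1.measurable (measurableSet_singleton _)
  have hBm' : MeasurableSet B := hL.meas (measurableSet_singleton _)
  set g : Ω → ℝ := B.indicator fun _ => (1:ℝ) with hg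
  have gi : Integrable g μ := (integrable_const _).indicator hBm'
  have lev := gi.tendsto_ae_condExp (ℱ := c.F) (by
    exact (stronglyMeasurable_const.indicator hBm))
  have key : ∀ n, ∀ᵐ ω ∂μ, (μ[g | c.F n]) ω ≤ 1 - (1/27)^2/7002/2 := by
    intro n
    set A : Set Ω := {ω | 1 - (1/27)^2/7002/2 < (μ[g | c.F n]) ω} with hA
    have mA : MeasurableSet[c.F n] A :=
      stronglyMeasurable_condExp.measurable measurableSet_Ioi
    have mA' := c.F.le _ _ mA
    have e1 : ∫ ω in A, (μ[g | c.F n]) ω ∂μ = μ.real (A ∩ B) := by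
      rw [setIntegral_condExp (c.F.le n) gi mA, hg, setIntegral_indicator hBm']
      simp
    have e2 : (1 - (1/27)^2/7002/2) * μ.real A ≤ ∫ ω in A, (μ[g | c.F n]) ω ∂μ := by
      have : ∫ ω in A, (1 - (1/27)^2/7002/2 : ℝ) ∂μ ≤ ∫ ω in A, (μ[g | c.F n]) ω ∂μ := by
        refine setIntegral_mono_on (integrable_const _).integrableOn integrable_condExp.integrableOn mA' ?_
        intro ω hω
        exact le_of_lt hω
      simpa [mul_comm] using this
    have e3 := hL.top_step hγ n mA
    have e4 : μ.real (A ∩ B) + μ.real (A ∩ Bᶜ) = μ.real A := by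
      rw [← diff_eq]
      exact measureReal_inter_add_diff hBm'
    have e5 : μ.real A = 0 := by
      have : 0 ≤ μ.real A := measureReal_nonneg
      rw [← hB] at e3
      rw [e1] at e2
      linarith
    rw [ae_iff]
    simp only [not_le]
    rwa [measureReal_eq_zero_iff] at e5
  filter_upwards [lev, ae_all_iff.2 key] with ω h1 h2
  have h3 := le_of_tendsto' h1 h2
  refine lt_of_le_of_ne (hL.2.1 ω).2 fun h => ?_
  have : g ω = 1 := by
    have : ω ∈ B := h
    simp [hg, this]
  rw [this] at h3
  norm_num at h3

end RPSChain

set_option linter.unusedSectionVars false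
namespace RPSChain
variable {Ω : Type*} [MeasurableSpace Ω] {μ : Measure Ω} {γ₀ : ℝ}
variable [IsProbabilityMeasure μ]

/-- noise increments -/
def dN (c : RPSChain μ γ₀) (α β : ℝ) (n : ℕ) (ω : Ω) : ℝ :=
  (α * c.X (n+1) ω + β * c.Y (n+1) ω) - (α * c.X n ω + β * c.Y n ω) -
    (2*α*c.X n ω*(c.Z n ω-c.Y n ω)+2*β*c.Y n ω*(c.X n ω-c.Z n ω))/rpsGamma γ₀ (n+1)

/-- noise -/
def NN (c : RPSChain μ γ₀) (α β : ℝ) (n : ℕ) (ω : Ω) : ℝ := ∑ k ∈ Finset.range n, c.dN α β k ω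

def xic (c : RPSChain μ γ₀) (α β : ℝ) (n : ℕ) (i : Fin 6) (ω : Ω) : ℝ :=
  xi α β (rpsGamma γ₀ n) i (c.X n ω) (c.Y n ω) (c.Z n ω)

lemma mxic (c : RPSChain μ γ₀) (α β : ℝ) (n : ℕ) (i : Fin 6) : Measurable[c.F n] (c.xic α β n i) := by
  have h1 := c.mX n
  have h2 := c.mY n
  have h3 := c.mZ n
  unfold xic xi
  fun_prop

lemma dN_eq (hγ : 2 ≤ γ₀) (c : RPSChain μ γ₀) (α β : ℝ) {n : ℕ} {i : Fin 6} {ω : Ω}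
    (h : ω ∈ c.Ev n i) : c.dN α β n ω = c.xic α β n i ω := by
  obtain ⟨h1, h2, h3⟩ := h
  have hg : 2 ≤ rpsGamma γ₀ n := gam_ge hγ n
  have hg' : rpsGamma γ₀ n + 4 ≠ 0 := by linarith
  unfold dN xic xi
  rw [h1, h2, gam_succ]
  field_simp
  ring

lemma mdN (c : RPSChain μ γ₀) (α β : ℝ) (n : ℕ) : Measurable[c.F (n+1)] (c.dN α β n) := by
  have h1 := (c.mX n).mono (c.F.mono (Nat.le_succ n)) le_rfl
  have h2 := (c.mY n).mono (c.F.mono (Nat.le_succ n)) le_rfl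
  have h3 := (c.mZ n).mono (c.F.mono (Nat.le_succ n)) le_rfl
  have h4 := c.mX (n+1)
  have h5 := c.mY (n+1)
  unfold dN
  fun_prop

lemma mNN (c : RPSChain μ γ₀) (α β : ℝ) (n : ℕ) : Measurable[c.F n] (c.NN α β n) := by
  unfold NN
  refine Finset.measurable_fun_sum _ fun k hk => ?_
  exact (c.mdN α β k).mono (c.F.mono (Finset.mem_range.1 hk)) le_rfl

lemma xic_abs (hγ : 2 ≤ γ₀) (c : RPSChain μ γ₀) {α β : ℝ} (hα : 0 ≤ α) (hβ : 0 ≤ β) (hα1 : α ≤ 1)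
    (hβ1 : β ≤ 1) (n : ℕ) (i : Fin 6) (ω : Ω) : |c.xic α β n i ω| ≤ 20 := by
  have hg : 2 ≤ rpsGamma γ₀ n := gam_ge hγ n
  have := xi_sq hg (c.nonneg_X n ω) (c.nonneg_Y n ω) (c.nonneg_Z n ω) (c.sum_eq_one n ω) hα hβ hα1 hβ1 i
  apply abs_le_of_sq_le_sq _ (by norm_num)
  refine this.trans ?_
  rw [div_le_iff₀ (by positivity)]
  nlinarith

lemma NN_abs (hγ : 2 ≤ γ₀) (c : RPSChain μ γ₀) {α β : ℝ} (hα : 0 ≤ α) (hβ : 0 ≤ β) (hα1 : α ≤ 1)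
    (hβ1 : β ≤ 1) (n : ℕ) : ∀ᵐ ω ∂μ, |c.NN α β n ω| ≤ 20 * n := by
  filter_upwards [c.ae_step hγ] with ω hω
  unfold NN
  refine (Finset.abs_sum_le_sum_abs _ _).trans ?_
  have : ∑ k ∈ Finset.range n, |c.dN α β k ω| ≤ ∑ k ∈ Finset.range n, (20:ℝ) := by
    refine Finset.sum_le_sum fun k _ => ?_
    obtain ⟨i, hi⟩ := hω k
    rw [c.dN_eq hγ α β hi]
    exact c.xic_abs hγ hα hβ hα1 hβ1 k i ω
  refine this.trans (le_of_eq ?_)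
  simp [mul_comm]

lemma NN_mart (hγ : 2 ≤ γ₀) (c : RPSChain μ γ₀) {α β : ℝ} (hα : 0 ≤ α) (hβ : 0 ≤ β) (hα1 : α ≤ 1)
    (hβ1 : β ≤ 1) : Martingale (c.NN α β) c.F μ := by
  have hi : ∀ n, Integrable (c.NN α β n) μ := fun n =>
    int_of_bdd (((c.mNN α β n).mono (c.F.le n) le_rfl).aemeasurable) (c.NN_abs hγ hα hβ hα1 hβ1 n)
  refine martingale_of_setIntegral_eq_succ (fun n => (c.mNN α β n).stronglyMeasurable) hi ?_
  intro n s hs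
  rw [← int_ind (c.F.le n s hs), ← int_ind (c.F.le n s hs)]
  have hw := c.wt_ind n hs
  have i01 : ∀ ω, 0 ≤ s.indicator (fun _ => (1:ℝ)) ω ∧ s.indicator (fun _ => (1:ℝ)) ω ≤ 1 := by
    intro ω
    by_cases h : ω ∈ s <;> simp [h]
  obtain ⟨a, b, e⟩ := c.step_int hγ n (fun i ω => s.indicator (fun _ => (1:ℝ)) ω * c.xic α β n i ω)
    (fun i => hw.1.mul (c.mxic α β n i)) 20 (by
      intro i
      refine ae_of_all _ fun ω => ?_
      rw [abs_mul, abs_of_nonneg (i01 ω).1]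
      exact (mul_le_of_le_one_left (abs_nonneg _) (i01 ω).2).trans (c.xic_abs hγ hα hβ hα1 hβ1 n i ω))
    (fun ω => s.indicator (fun _ => (1:ℝ)) ω * c.dN α β n ω)
    (ae_of_all _ fun ω i h => by simp only [c.dN_eq hγ α β h])
  have z : ∫ ω, s.indicator (fun _ => (1:ℝ)) ω * c.dN α β n ω ∂μ = 0 := by
    rw [e]
    refine integral_eq_zero_of_ae (ae_of_all _ fun ω => ?_)
    have := L5 (α := α) (β := β) (γ := rpsGamma γ₀ n) (c.sum_eq_one n ω)
    calc ∑ i, c.pr n i ω * (s.indicator (fun _ => (1:ℝ)) ω * c.xic α β n i ω)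
        = s.indicator (fun _ => (1:ℝ)) ω * ∑ i, c.pr n i ω * c.xic α β n i ω := by
          rw [Finset.mul_sum]; congr 1; ext i; ring
      _ = 0 := by
          simp only [pr, xic]
          rw [this, mul_zero]
  have hN := hw.int (((c.mNN α β n).mono (c.F.le n) le_rfl).aemeasurable) _ (c.NN_abs hγ hα hβ hα1 hβ1 n)
  have : ∫ ω, s.indicator (fun _ => (1:ℝ)) ω * c.NN α β (n+1) ω ∂μ =
    ∫ ω, s.indicator (fun _ => (1:ℝ)) ω * c.NN α β n ω ∂μ +
      ∫ ω, s.indicator (fun _ => (1:ℝ)) ω * c.dN α β n ω ∂μ := by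
    rw [← integral_add hN a]
    congr 1; ext ω
    simp only [NN, Finset.sum_range_succ]
    ring
  rw [this, z, add_zero]

lemma NN_sq (hγ : 2 ≤ γ₀) (c : RPSChain μ γ₀) {α β : ℝ} (hα : 0 ≤ α) (hβ : 0 ≤ β) (hα1 : α ≤ 1)
    (hβ1 : β ≤ 1) (n : ℕ) : Integrable (fun ω => c.NN α β n ω^2) μ ∧
    ∫ ω, c.NN α β n ω^2 ∂μ ≤ 100 * (1/rpsGamma γ₀ 0 - 1/rpsGamma γ₀ n) := by
  have hi : ∀ n, Integrable (fun ω => c.NN α β n ω^2) μ := fun n =>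
    int_of_bdd (K := (20*n)^2) ((((c.mNN α β n).mono (c.F.le n) le_rfl).pow_const 2).aemeasurable) (by
      filter_upwards [c.NN_abs hγ hα hβ hα1 hβ1 n] with ω h
      rw [abs_pow]
      gcongr)
  refine ⟨hi n, ?_⟩
  induction n with
  | zero => simp [NN]
  | succ n ih =>
    have hg : 2 ≤ rpsGamma γ₀ n := gam_ge hγ n
    obtain ⟨a, b, e⟩ := c.step_int hγ n (fun i ω => (c.NN α β n ω + c.xic α β n i ω)^2)
      (fun i => ((c.mNN α β n).add (c.mxic α β n i)).pow_const 2) ((20*n+20)^2) (by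
        intro i
        filter_upwards [c.NN_abs hγ hα hβ hα1 hβ1 n] with ω h
        rw [abs_pow]
        have h2 := c.xic_abs hγ hα hβ hα1 hβ1 n i ω
        have := abs_add_le (c.NN α β n ω) (c.xic α β n i ω)
        gcongr
        linarith)
      (fun ω => c.NN α β (n+1) ω^2)
      (ae_of_all _ fun ω i h => by
        simp only [NN, Finset.sum_range_succ]
        rw [c.dN_eq hγ α β h])
    rw [e]
    have : ∫ ω, ∑ i, c.pr n i ω * (c.NN α β n ω + c.xic α β n i ω)^2 ∂μ ≤
      ∫ ω, (c.NN α β n ω^2 + 400/(rpsGamma γ₀ n+4)^2) ∂μ := by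
      refine integral_mono b ((hi n).add (integrable_const _)) ?_
      intro ω
      have l5 := L5 (α := α) (β := β) (γ := rpsGamma γ₀ n) (c.sum_eq_one n ω)
      have ps : ∑ i, c.pr n i ω = 1 := rpsProb_sum (c.sum_eq_one n ω)
      have l6 : ∑ i, c.pr n i ω * c.xic α β n i ω^2 ≤ 400/(rpsGamma γ₀ n+4)^2 := by
        calc _ ≤ ∑ i, c.pr n i ω * (400/(rpsGamma γ₀ n+4)^2) := by
              refine Finset.sum_le_sum fun i _ => ?_
              have := xi_sq hg (c.nonneg_X n ω) (c.nonneg_Y n ω) (c.nonneg_Z n ω) (c.sum_eq_one n ω) hα hβ hα1 hβ1 i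
              have p := rpsProb_nonneg (c.nonneg_X n ω) (c.nonneg_Y n ω) (c.nonneg_Z n ω) i
              exact mul_le_mul_of_nonneg_left this p
          _ = _ := by rw [← Finset.sum_mul, ps, one_mul]
      have : ∑ i, c.pr n i ω * (c.NN α β n ω + c.xic α β n i ω)^2 =
        c.NN α β n ω^2 * ∑ i, c.pr n i ω + 2*c.NN α β n ω * ∑ i, c.pr n i ω * c.xic α β n i ω +
          ∑ i, c.pr n i ω * c.xic α β n i ω^2 := by
        simp only [Finset.mul_sum, ← Finset.sum_add_distrib]
        congr 1; ext i; ring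
      have l5' : ∑ i, c.pr n i ω * c.xic α β n i ω = 0 := l5
      simp only
      rw [this, ps, l5']
      linarith
    rw [integral_add (hi n) (integrable_const _)] at this
    have t := gam_tel hγ n
    simp only [integral_const, probReal_univ, one_smul] at this
    have : 400/(rpsGamma γ₀ n+4)^2 = 400 * (1/(rpsGamma γ₀ n+4)^2) := by ring
    linarith

lemma NN_conv (hγ : 2 ≤ γ₀) (c : RPSChain μ γ₀) {α β : ℝ} (hα : 0 ≤ α) (hβ : 0 ≤ β) (hα1 : α ≤ 1)
    (hβ1 : β ≤ 1) : ∀ᵐ ω ∂μ, ∃ l, Tendsto (fun n => c.NN α β n ω) atTop (𝓝 l) := by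
  have hm := c.NN_mart hγ hα hβ hα1 hβ1
  refine hm.submartingale.exists_ae_tendsto_of_bdd (R := 51) ?_
  intro n
  obtain ⟨i2, h2⟩ := c.NN_sq hγ hα hβ hα1 hβ1 n
  have i1 := hm.integrable n
  rw [eLpNorm_one_eq_lintegral_enorm, ← ofReal_integral_norm_eq_lintegral_enorm i1]
  have : ∫ ω, ‖c.NN α β n ω‖ ∂μ ≤ ∫ ω, (1 + c.NN α β n ω^2) ∂μ := by
    refine integral_mono i1.norm ((integrable_const _).add i2) ?_
    intro ω
    simp only [Real.norm_eq_abs]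
    rw [← sq_abs]
    nlinarith [sq_nonneg (|c.NN α β n ω| - 1)]
  rw [integral_add (integrable_const _) i2] at this
  simp only [integral_const, probReal_univ, one_smul] at this
  have b : 1/rpsGamma γ₀ 0 ≤ 1/2 := one_div_le_one_div_of_le (by norm_num) (gam_ge hγ 0)
  have b2 : 0 < 1/rpsGamma γ₀ n := one_div_pos.2 (by linarith [gam_ge hγ n])
  refine (ENNReal.ofReal_le_ofReal (show _ ≤ (51:ℝ) by linarith)).trans ?_
  simp

end RPSChain

set_option linter.unusedSectionVars false
namespace RPSChain
variable {Ω : Type*} [MeasurableSpace Ω] {μ : Measure Ω} {γ₀ : ℝ}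
variable [IsProbabilityMeasure μ]

lemma pos_step (c : RPSChain μ γ₀) (n : ℕ) (i : Fin 6) {A : Set Ω} (hA : MeasurableSet[c.F n] A)
    (h0 : 0 < μ.real A) {δ : ℝ} (hδ : 0 < δ) (h : ∀ ω ∈ A, δ ≤ c.pr n i ω) :
    0 < μ.real (A ∩ c.Ev n i) := by
  have hA' := c.F.le _ _ hA
  have hw := c.wt_ind n hA
  have e := c.step_one n i (A.indicator fun _ => (1:ℝ)) hw.1 1 (by
    refine ae_of_all _ fun ω => ?_
    by_cases h : ω ∈ A <;> simp [h])
  have e1 : μ.real (A ∩ c.Ev n i) = ∫ ω, A.indicator (fun _ => (1:ℝ)) ω *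
      (c.Ev n i).indicator (fun _ => (1:ℝ)) ω ∂μ := by
    rw [int_ind hA', setIntegral_indicator (c.mEv n i)]
    simp
  rw [e1, e]
  have hi : Integrable (fun ω => A.indicator (fun _ => (1:ℝ)) ω * c.pr n i ω) μ :=
    hw.int ((c.mpr n i).mono (c.F.le n) le_rfl).aemeasurable 1 (ae_of_all _ fun ω => by
      rw [abs_of_nonneg (c.pr_nonneg n i ω)]
      exact c.pr_le n i ω)
  have : ∫ ω, δ * A.indicator (fun _ => (1:ℝ)) ω ∂μ ≤ ∫ ω, A.indicator (fun _ => (1:ℝ)) ω * c.pr n i ω ∂μ := by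
    refine integral_mono (hw.int1.const_mul _) hi ?_
    intro ω
    by_cases hh : ω ∈ A
    · simpa [hh] using h ω hh
    · simp [hh]
  rw [integral_const_mul, integral_indicator_const _ hA'] at this
  refine lt_of_lt_of_le ?_ this
  simp only [smul_eq_mul, mul_one]
  positivity

/-- the event that the degrees at time `n` are prescribed -/
def At (c : RPSChain μ γ₀) (n : ℕ) (p : ℝ × ℝ × ℝ) : Set Ω :=
  {ω | rpsGamma γ₀ n * c.X n ω = p.1 ∧ rpsGamma γ₀ n * c.Y n ω = p.2.1 ∧
    rpsGamma γ₀ n * c.Z n ω = p.2.2}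

lemma mAt (c : RPSChain μ γ₀) (n : ℕ) (p : ℝ × ℝ × ℝ) : MeasurableSet[c.F n] (c.At n p) := by
  have h1 := c.mX n
  have h2 := c.mY n
  have h3 := c.mZ n
  have a : MeasurableSet[c.F n] {ω | rpsGamma γ₀ n * c.X n ω = p.1} :=
    (h1.const_mul (rpsGamma γ₀ n)) (measurableSet_singleton _)
  have b : MeasurableSet[c.F n] {ω | rpsGamma γ₀ n * c.Y n ω = p.2.1} :=
    (h2.const_mul (rpsGamma γ₀ n)) (measurableSet_singleton _)
  have e : MeasurableSet[c.F n] {ω | rpsGamma γ₀ n * c.Z n ω = p.2.2} :=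
    (h3.const_mul (rpsGamma γ₀ n)) (measurableSet_singleton _)
  exact @MeasurableSet.inter _ (c.F n) _ _ a (@MeasurableSet.inter _ (c.F n) _ _ b e)

lemma At_step (hγ : 2 ≤ γ₀) (c : RPSChain μ γ₀) (n : ℕ) (p : ℝ × ℝ × ℝ) (h0 : 0 < μ.real (c.At n p))
    (i : Fin 6) {δ : ℝ} (hδ : 0 < δ) (h : ∀ ω ∈ c.At n p, δ ≤ c.pr n i ω) :
    0 < μ.real (c.At (n+1) (p + rpsIncr i)) := by
  refine lt_of_lt_of_le (c.pos_step n i (c.mAt n p) h0 hδ h) (measureReal_mono ?_)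
  rintro ω ⟨⟨h1, h2, h3⟩, hE⟩
  obtain ⟨a, b, e⟩ := c.deg_succ hγ hE
  refine ⟨?_, ?_, ?_⟩
  · rw [a, h1]; rfl
  · rw [b, h2]; rfl
  · rw [e, h3]; rfl

lemma At_pos (hγ : 2 ≤ γ₀) (c : RPSChain μ γ₀) (ω₀ : Ω) (i j k : ℕ) :
    0 < μ.real (c.At (i+j+k) (γ₀ * c.X 0 ω₀ + 4*i, γ₀ * c.Y 0 ω₀ + 4*j, γ₀ * c.Z 0 ω₀ + 4*k)) := by
  have x0 := c.init_X_pos ω₀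
  have y0 := c.init_Y_pos ω₀
  have z0 := c.init_Z_pos ω₀
  have aux : ∀ (n : ℕ) (s t : ℝ), 0 < s → rpsGamma γ₀ n * t = s → (s / rpsGamma γ₀ n)^2 ≤ t^2 ∧
      0 < (s / rpsGamma γ₀ n)^2 := by
    intro n s t hs h
    have hg : 0 < rpsGamma γ₀ n := by linarith [gam_ge hγ n]
    have : s / rpsGamma γ₀ n = t := by rw [← h]; field_simp
    refine ⟨by rw [this], by positivity⟩
  induction k with
  | zero =>
    induction j with
    | zero =>
      induction i with
      | zero =>
        have : c.At (0+0+0) (γ₀ * c.X 0 ω₀ + 4*(0:ℕ), γ₀ * c.Y 0 ω₀ + 4*(0:ℕ), γ₀ * c.Z 0 ω₀ + 4*(0:ℕ)) = univ := by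
          refine eq_univ_of_forall fun ω => ?_
          refine ⟨?_, ?_, ?_⟩
          · simp [rpsGamma, c.init_X_const ω ω₀]
          · simp [rpsGamma, c.init_Y_const ω ω₀]
          · simp [rpsGamma, c.init_Z_const ω ω₀]
        rw [this]; simp
      | succ i ih =>
        have := c.At_step hγ _ _ ih 0
          (δ := ((γ₀ * c.X 0 ω₀ + 4*i)/rpsGamma γ₀ (i+0+0))^2) (by
            have hg : 0 < rpsGamma γ₀ (i+0+0) := by linarith [gam_ge hγ (i+0+0)]
            positivity) (fun ω hω => (aux _ _ _ (by positivity) hω.1).1)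
        convert this using 3
        all_goals first | omega | (simp [rpsIncr]; ring)
    | succ j ih =>
      have := c.At_step hγ _ _ ih 1
          (δ := ((γ₀ * c.Y 0 ω₀ + 4*j)/rpsGamma γ₀ (i+j+0))^2) (by
            have hg : 0 < rpsGamma γ₀ (i+j+0) := by linarith [gam_ge hγ (i+j+0)]
            positivity) (fun ω hω => (aux _ _ _ (by positivity) hω.2.1).1)
      convert this using 3
      all_goals first | omega | (simp [rpsIncr]; ring)
  | succ k ih =>
    have := c.At_step hγ _ _ ih 2
          (δ := ((γ₀ * c.Z 0 ω₀ + 4*k)/rpsGamma γ₀ (i+j+k))^2) (by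
            have hg : 0 < rpsGamma γ₀ (i+j+k) := by linarith [gam_ge hγ (i+j+k)]
            positivity) (fun ω hω => (aux _ _ _ (by positivity) hω.2.2).1)
    convert this using 3
    all_goals first | omega | (simp [rpsIncr]; ring)

lemma frac_tendsto (γ₀ s t : ℝ) {f n : ℕ → ℕ} (hf : Tendsto (fun N => (f N:ℝ)/N) atTop (𝓝 t))
    (hn : Tendsto (fun N => (n N:ℝ)/N) atTop (𝓝 1)) :
    Tendsto (fun N => (s + 4 * f N)/rpsGamma γ₀ (n N)) atTop (𝓝 t) := by
  have h1 : Tendsto (fun N : ℕ => s/(N:ℝ) + 4 * ((f N:ℝ)/N)) atTop (𝓝 (0+4*t)) :=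
    (tendsto_const_div_atTop_nhds_zero_nat s).add (hf.const_mul 4)
  have h2 : Tendsto (fun N : ℕ => γ₀/(N:ℝ) + 4 * ((n N:ℝ)/N)) atTop (𝓝 (0+4*1)) :=
    (tendsto_const_div_atTop_nhds_zero_nat γ₀).add (hn.const_mul 4)
  have h3 := h1.div h2 (by norm_num)
  have e : (0+4*t)/(0+4*1) = t := by ring
  rw [e] at h3
  refine h3.congr' ?_
  filter_upwards [eventually_gt_atTop 0] with N hN
  have : (N:ℝ) ≠ 0 := by positivity
  simp only [Pi.div_apply, rpsGamma]
  rw [← mul_div_assoc, ← mul_div_assoc, ← add_div, ← add_div, div_div_div_cancel_right₀ this]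

lemma IsLim.supp {c : RPSChain μ γ₀} {L : Ω → ℝ} (hγ : 2 ≤ γ₀) (hL : c.IsLim L) {a b : ℝ}
    (ha : 0 ≤ a) (hab : a < b) (hb : b ≤ 1/27) : ¬ ∀ᵐ ω ∂μ, L ω ∉ Ioo a b := by
  intro hno
  obtain ⟨ω₀⟩ : Nonempty Ω := nonempty_of_isProbabilityMeasure μ
  obtain ⟨t, ht, htm⟩ : ∃ t ∈ Icc (0:ℝ) (1/3), t*t*(1-2*t) = (a+b)/2 := by
    have := intermediate_value_Icc (f := fun t : ℝ => t*t*(1-2*t)) (show (0:ℝ) ≤ 1/3 by norm_num)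
      (by fun_prop)
    have h2 : (a+b)/2 ∈ Icc ((fun t : ℝ => t*t*(1-2*t)) 0) ((fun t : ℝ => t*t*(1-2*t)) (1/3)) := by
      constructor
      · simp; linarith
      · norm_num; linarith
    exact this h2
  set f : ℕ → ℕ := fun N => ⌊t * N⌋₊ with hf
  set g : ℕ → ℕ := fun N => ⌊(1-2*t) * N⌋₊ with hg
  have tf : Tendsto (fun N => (f N:ℝ)/N) atTop (𝓝 t) :=
    (tendsto_nat_floor_mul_div_atTop ht.1).comp tendsto_natCast_atTop_atTop
  have tg : Tendsto (fun N => (g N:ℝ)/N) atTop (𝓝 (1-2*t)) :=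
    (tendsto_nat_floor_mul_div_atTop (by linarith [ht.2])).comp tendsto_natCast_atTop_atTop
  have tn : Tendsto (fun N => ((f N + f N + g N : ℕ):ℝ)/N) atTop (𝓝 1) := by
    have := (tf.add tf).add tg
    rw [show t + t + (1-2*t) = 1 by ring] at this
    refine this.congr fun N => ?_
    push_cast
    ring
  have tn2 : Tendsto (fun N => f N + f N + g N) atTop atTop := by
    rw [← tendsto_natCast_atTop_iff (R := ℝ)]
    have h1 : Tendsto (fun N : ℕ => (N:ℝ) * (((f N + f N + g N : ℕ):ℝ)/N)) atTop atTop :=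
      tendsto_natCast_atTop_atTop.atTop_mul_pos one_pos tn
    refine h1.congr' ?_
    filter_upwards [eventually_gt_atTop 0] with N hN
    have : (N:ℝ) ≠ 0 := by positivity
    field_simp
  have tm := ((frac_tendsto γ₀ (γ₀ * c.X 0 ω₀) t tf tn).mul
    (frac_tendsto γ₀ (γ₀ * c.Y 0 ω₀) t tf tn)).mul (frac_tendsto γ₀ (γ₀ * c.Z 0 ω₀) (1-2*t) tg tn)
  rw [htm] at tm
  set ρ := (b-a)/4 with hρ
  have hρ0 : 0 < ρ := by rw [hρ]; linarith
  have ti := ((gam_inv γ₀).comp tn2).const_mul (3500/27)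
  rw [mul_zero] at ti
  have ev1 := tm.eventually (Ioo_mem_nhds (show (a+b)/2 - ρ < (a+b)/2 by linarith) (show (a+b)/2 < (a+b)/2 + ρ by linarith))
  have ev2 := ti.eventually (gt_mem_nhds (show 0 < ρ^2 by positivity))
  obtain ⟨N, h1, h2⟩ := (ev1.and ev2).exists
  have pA := c.At_pos hγ ω₀ (f N) (f N) (g N)
  set n := f N + f N + g N with hn
  set p : ℝ × ℝ × ℝ := (γ₀ * c.X 0 ω₀ + 4*(f N:ℕ), γ₀ * c.Y 0 ω₀ + 4*(f N:ℕ), γ₀ * c.Z 0 ω₀ + 4*(g N:ℕ)) with hp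
  have mA := c.mAt n p
  have mA' := c.F.le _ _ mA
  have hw := c.wt_ind n mA
  have hgn : 0 < rpsGamma γ₀ n := by linarith [gam_ge hγ n]
  have bd := hL.bound hγ n _ hw c.MM (Or.inl rfl)
  have b1 : ∫ ω, (c.At n p).indicator (fun _ => (1:ℝ)) ω * c.MM n ω ∂μ ≤ 1/27 * μ.real (c.At n p) := by
    have : ∫ ω, (c.At n p).indicator (fun _ => (1:ℝ)) ω * c.MM n ω ∂μ ≤
      ∫ ω, (c.At n p).indicator (fun _ => (1:ℝ)) ω * (1/27) ∂μ := by
      refine integral_mono (hw.intM n) (hw.int1.mul_const _) fun ω => ?_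
      exact mul_le_mul_of_nonneg_left (c.MM_le n ω) (hw.2.1 ω)
    rw [integral_mul_const, integral_indicator_const _ mA'] at this
    simpa [mul_comm] using this
  have b2 : ρ^2 * μ.real (c.At n p) ≤
      ∫ ω, (c.At n p).indicator (fun _ => (1:ℝ)) ω * (L ω - c.MM n ω)^2 ∂μ := by
    have : ∫ ω, (c.At n p).indicator (fun _ => (1:ℝ)) ω * ρ^2 ∂μ ≤
      ∫ ω, (c.At n p).indicator (fun _ => (1:ℝ)) ω * (L ω - c.MM n ω)^2 ∂μ := by
      refine integral_mono_ae (hw.int1.mul_const _) (hL.intQ hw n) ?_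
      filter_upwards [hno] with ω hω
      by_cases hA : ω ∈ c.At n p
      · simp only [indicator_of_mem hA, one_mul]
        obtain ⟨q1, q2, q3⟩ := hA
        have hM : c.MM n ω = (γ₀ * c.X 0 ω₀ + 4*(f N:ℕ))/rpsGamma γ₀ n * ((γ₀ * c.Y 0 ω₀ + 4*(f N:ℕ))/rpsGamma γ₀ n) * ((γ₀ * c.Z 0 ω₀ + 4*(g N:ℕ))/rpsGamma γ₀ n) := by
          simp only [hp] at q1 q2 q3
          rw [← q1, ← q2, ← q3, MM]
          field_simp
        rw [← hM] at h1
        obtain ⟨u, v⟩ := h1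
        have : L ω ≤ a ∨ b ≤ L ω := by
          by_contra hc
          push Not at hc
          exact hω ⟨hc.1, hc.2⟩
        rcases this with h | h
        · nlinarith
        · nlinarith
      · simp [hA]
    rw [integral_mul_const, integral_indicator_const _ mA'] at this
    simpa [mul_comm] using this
  have b3 : 3500/rpsGamma γ₀ n * (1/27 * μ.real (c.At n p)) < ρ^2 * μ.real (c.At n p) := by
    have h2' : 3500/27 * (1/rpsGamma γ₀ n) < ρ^2 := h2
    calc _ = 3500/27 * (1/rpsGamma γ₀ n) * μ.real (c.At n p) := by ring
      _ < _ := by gcongr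
  have b4 : 3500/rpsGamma γ₀ n * ∫ ω, (c.At n p).indicator (fun _ => (1:ℝ)) ω * c.MM n ω ∂μ ≤
    3500/rpsGamma γ₀ n * (1/27 * μ.real (c.At n p)) := by gcongr
  linarith

end RPSChain

set_option linter.unusedSectionVars false
namespace RPSChain

lemma kq {a b t : ℝ} (ha : a ≤ 0) (hb : b ≤ 0) (ha' : -t ≤ a) (hb' : -t ≤ b) :
    a*b*(-a-b) ≤ 2*(a^2+a*b+b^2)*t/3 := by
  have h1 : 0 ≤ a*b := mul_nonneg_of_nonpos_of_nonpos ha hb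
  have ht : 0 ≤ t := by linarith
  have h2 : a*b*(-a-b) ≤ a*b*(2*t) := mul_le_mul_of_nonneg_left (by linarith) h1
  have h3 : 0 ≤ t*(a-b)^2 := by positivity
  nlinarith

lemma kq3 {a b e t : ℝ} (h : a + b + e = 0) (ha : -t ≤ a) (hb : -t ≤ b) (he : -t ≤ e) :
    a*b*e ≤ (a^2+b^2+e^2)*t/3 := by
  have ht : 0 ≤ t := by linarith
  by_cases hk : a*b*e ≤ 0
  · exact hk.trans (by positivity)
  push Not at hk
  rcases le_total a 0 with h1 | h1
  · rcases le_total b 0 with h2 | h2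
    · have := kq h1 h2 ha hb
      have e1 : e = -a-b := by linarith
      subst e1
      linarith
    · rcases le_total e 0 with h3 | h3
      · have := kq h1 h3 ha he
        have e1 : b = -a-e := by linarith
        subst e1
        linarith
      · exfalso
        nlinarith [mul_nonneg h2 h3]
  · rcases le_total b 0 with h2 | h2
    · rcases le_total e 0 with h3 | h3
      · have := kq h2 h3 hb he
        have e1 : a = -b-e := by linarith
        subst e1
        linarith
      · exfalso
        nlinarith [mul_nonneg h1 h3]
    · exfalso
      have : e ≤ 0 := by linarith
      nlinarith [mul_nonneg h1 h2]

lemma ray_lt {a b e s : ℝ} (h : a + b + e = 0) (hs : 1 < s) (ha : 0 ≤ 1/3 + s*a) (hb : 0 ≤ 1/3 + s*b)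
    (he : 0 ≤ 1/3 + s*e) (h0 : 0 < a^2+b^2+e^2) :
    (1/3+s*a)*(1/3+s*b)*(1/3+s*e) < (1/3+a)*(1/3+b)*(1/3+e) := by
  have hs0 : 0 < s := by linarith
  have aux : ∀ t, 0 ≤ 1/3 + s*t → -(1/(3*s)) ≤ t := by
    intro t ht
    have : s * (-(1/(3*s))) ≤ s * t := by
      have : s * (-(1/(3*s))) = -(1/3) := by field_simp
      linarith
    exact le_of_mul_le_mul_left this hs0
  have k := kq3 h (aux a ha) (aux b hb) (aux e he)
  have e1 : e = -a-b := by linarith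
  set Q := a^2+b^2+e^2 with hQ
  have id1 : (1/3+a)*(1/3+b)*(1/3+e) - (1/3+s*a)*(1/3+s*b)*(1/3+s*e) =
      (s-1)*((s+1)*Q/6 - (s^2+s+1)*(a*b*e)) := by
    rw [hQ, e1]; ring
  have k2 : 9*s*(a*b*e) ≤ Q := by
    have : Q * (1/(3*s))/3 = Q/(9*s) := by field_simp; norm_num
    rw [this, le_div_iff₀ (by positivity)] at k
    linarith
  have k3 : 0 < (s+1)*Q/6 - (s^2+s+1)*(a*b*e) := by
    have : 0 < 9*s*((s+1)*Q/6 - (s^2+s+1)*(a*b*e)) := by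
      have h5 : (s^2+s+1)*(9*s*(a*b*e)) ≤ (s^2+s+1)*Q := mul_le_mul_of_nonneg_left k2 (by positivity)
      have h6 : 0 < (s-1)*(s+2)*Q := by
        have : 0 < s-1 := by linarith
        positivity
      nlinarith
    exact (pos_iff_pos_of_mul_pos this).1 (by positivity)
  have : 0 < (s-1)*((s+1)*Q/6 - (s^2+s+1)*(a*b*e)) := mul_pos (by linarith) k3
  linarith

lemma ray_inj {a b e s : ℝ} (h : a + b + e = 0) (hs : 0 < s) (ha : 0 ≤ 1/3 + s*a) (hb : 0 ≤ 1/3 + s*b)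
    (he : 0 ≤ 1/3 + s*e) (ha' : 0 ≤ 1/3 + a) (hb' : 0 ≤ 1/3 + b) (he' : 0 ≤ 1/3 + e)
    (h0 : 0 < a^2+b^2+e^2)
    (heq : (1/3+s*a)*(1/3+s*b)*(1/3+s*e) = (1/3+a)*(1/3+b)*(1/3+e)) : s = 1 := by
  rcases lt_trichotomy s 1 with h1 | h1 | h1
  · exfalso
    have c : ∀ t, s⁻¹ * (s * t) = t := fun t => by field_simp
    have := ray_lt (a := s*a) (b := s*b) (e := s*e) (s := s⁻¹) (by rw [← mul_add, ← mul_add, h, mul_zero])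
      ((one_lt_inv₀ hs).2 h1) (by rwa [c]) (by rwa [c]) (by rwa [c]) (by
        have : (s*a)^2+(s*b)^2+(s*e)^2 = s^2*(a^2+b^2+e^2) := by ring
        rw [this]; positivity)
    rw [c, c, c] at this
    linarith
  · exact h1
  · exact absurd heq (ray_lt h h1 ha hb he h0).ne

lemma cross_ge {x y z : ℝ} (hx : 0 ≤ x) (hy : 0 ≤ y) (hz : 0 ≤ z) (h : x + y + z = 1) :
    3*(x*y*z)*(1-27*(x*y*z)) ≤ (x-1/3)*(2*y*(x-z)) - (y-1/3)*(2*x*(z-y)) := by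
  have id1 : (x-1/3)*(2*y*(x-z)) - (y-1/3)*(2*x*(z-y)) = 2/3*((x*y+y*z+z*x) - 9*(x*y*z)) := by
    have : z = 1-x-y := by linarith
    rw [this]; ring
  rw [id1]
  set s := x*y+y*z+z*x with hs
  have hM := M_le hx hy hz h
  have hM0 : 0 ≤ x*y*z := by positivity
  set m := x*y*z with hm
  have s1 : 3*m ≤ s^2 := by
    have : s^2 - 3*m*(x+y+z) = ((x*y-y*z)^2+(y*z-z*x)^2+(z*x-x*y)^2)/2 := by rw [hs, hm]; ring
    rw [h] at this
    nlinarith [sq_nonneg (x*y-y*z), sq_nonneg (y*z-z*x), sq_nonneg (z*x-x*y)]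
  have s2 : s ≤ 1/3 := by
    have : (x+y+z)^2 - 3*s = ((x-y)^2+(y-z)^2+(z-x)^2)/2 := by rw [hs]; ring
    rw [h] at this
    nlinarith [sq_nonneg (x-y), sq_nonneg (y-z), sq_nonneg (z-x)]
  have s0 : 0 ≤ s := by positivity
  have s3 : 9*m ≤ s := by
    apply le_of_sq_le_sq _ s0
    nlinarith
  nlinarith [mul_nonneg (sub_nonneg.2 s3) (show 0 ≤ 2/3 - (s+9*m) by linarith)]

end RPSChain

set_option linter.unusedSectionVars false
namespace RPSChain

lemma winding {V η : ℕ → ℂ} {e : ℕ → ℝ} {κ c K : ℝ} (hκ : 0 < κ) (hc : 0 < c)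
    (hV0 : ∀ᶠ n in atTop, V n ≠ 0) (hV : ∀ᶠ n in atTop, V (n+1) = V n * (1 + η n))
    (he0 : ∀ n, 0 < e n) (he : Tendsto e atTop (𝓝 0))
    (hs : Tendsto (fun n => ∑ k ∈ Finset.range n, e k) atTop atTop)
    (hη : ∀ᶠ n in atTop, ‖η n‖ ≤ K * e n) (hi : ∀ᶠ n in atTop, c * e n ≤ (η n).im)
    (harg : ∀ᶠ n in atTop, |(V n).arg| ≤ Real.pi - κ) : False := by
  have hKe : Tendsto (fun n => K * e n) atTop (𝓝 0) := by simpa using he.const_mul K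
  have hKKe : Tendsto (fun n => K^2 * e n) atTop (𝓝 0) := by simpa using he.const_mul (K^2)
  have hsm : ∀ᶠ n in atTop, ‖η n‖ ≤ 1/2 ∧ 3/2*‖η n‖ < κ ∧ K^2 * e n ≤ c/2 := by
    filter_upwards [hη, hKe.eventually (ge_mem_nhds (show (0:ℝ) < 1/2 by norm_num)),
      hKe.eventually (gt_mem_nhds (show (0:ℝ) < κ/2 by linarith)),
      hKKe.eventually (ge_mem_nhds (show (0:ℝ) < c/2 by linarith))] with n h1 h2 h3 h4
    exact ⟨h1.trans h2, by linarith, h4⟩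
  have step : ∀ᶠ n in atTop, (V n).arg + c/2 * e n ≤ (V (n+1)).arg := by
    filter_upwards [hV0, hV, hη, hi, harg, hsm] with n h0 h1 h2 h3 h4 ⟨h5, h6, h7⟩
    have hl1 := Complex.norm_log_one_add_half_le_self h5
    have hl2 := Complex.norm_log_one_add_sub_self_le (z := η n) (by linarith)
    have hne : 1 + η n ≠ 0 := by
      intro h
      have : η n = -1 := by linear_combination h
      rw [this] at h5; norm_num at h5
    have ha : (Complex.log (1 + η n)).im = (1 + η n).arg := Complex.log_im _
    have hab : |(1 + η n).arg| < κ := by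
      rw [← ha]; exact (Complex.abs_im_le_norm _).trans_lt (hl1.trans_lt h6)
    have hb : (η n).im - ‖η n‖^2 ≤ (1 + η n).arg := by
      have h8 := Complex.abs_im_le_norm (Complex.log (1 + η n) - η n)
      rw [Complex.sub_im, ha] at h8
      have h9 : (1 - ‖η n‖)⁻¹ ≤ 2 := by
        rw [inv_le_comm₀ (by linarith) (by norm_num)]; linarith
      have h10 : ‖η n‖^2 * (1 - ‖η n‖)⁻¹ / 2 ≤ ‖η n‖^2 := by
        nlinarith [sq_nonneg ‖η n‖]
      have := (abs_le.1 (h8.trans (hl2.trans h10))).1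
      linarith
    have hsq : ‖η n‖^2 ≤ c/2 * e n := by
      have : ‖η n‖^2 ≤ (K * e n)^2 := pow_le_pow_left₀ (norm_nonneg _) h2 2
      have h11 : (K^2 * e n) * e n ≤ c/2 * e n := mul_le_mul_of_nonneg_right h7 (he0 n).le
      nlinarith
    rw [h1, (Complex.arg_mul_eq_add_arg_iff h0 hne).2]
    · linarith
    · have := abs_le.1 h4
      have := abs_lt.1 hab
      constructor <;> linarith
  obtain ⟨N, hN⟩ := eventually_atTop.1 step
  have hind : ∀ n, N ≤ n → (V N).arg + c/2 * (∑ k ∈ Finset.range n, e k - ∑ k ∈ Finset.range N, e k) ≤ (V n).arg := by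
    intro n hn
    induction n, hn using Nat.le_induction with
    | base => simp
    | succ n hn ih =>
      rw [Finset.sum_range_succ]
      have := hN n hn
      linarith
  have ht : Tendsto (fun n => (V N).arg + c/2 * (∑ k ∈ Finset.range n, e k - ∑ k ∈ Finset.range N, e k)) atTop atTop := by
    apply tendsto_atTop_add_const_left
    apply Tendsto.const_mul_atTop (by linarith)
    exact tendsto_atTop_add_const_right _ _ hs
  obtain ⟨n, h1, h2⟩ := ((ht.eventually_gt_atTop Real.pi).and (eventually_ge_atTop N)).exists
  have := hind n h2
  have := Complex.arg_le_pi (V n)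
  linarith

lemma avoid {x y : ℕ → ℝ} {W : ℕ → ℂ} {M p q : ℝ} (hx : ∀ n, 0 ≤ x n) (hy : ∀ n, 0 ≤ y n)
    (hz : ∀ n, 0 ≤ 1 - x n - y n)
    (hW : Tendsto (fun n => W n - (⟨x n - 1/3, y n - 1/3⟩ : ℂ)) atTop (𝓝 0))
    (hM : Tendsto (fun n => x n * y n * (1 - x n - y n)) atTop (𝓝 M)) (hM1 : M < 1/27)
    (hp : 0 ≤ p) (hq : 0 ≤ q) (hr : 0 ≤ 1 - p - q) (hpq : p * q * (1 - p - q) = M)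
    {s : Set (ℝ × ℝ)} (hs : s ∈ 𝓝 (p, q)) (hav : ∀ᶠ n in atTop, (x n, y n) ∉ s) :
    ∃ κ > 0, ∀ᶠ n in atTop, |(-(W n) / (⟨p - 1/3, q - 1/3⟩ : ℂ)).arg| ≤ Real.pi - κ := by
  by_contra hcon
  push Not at hcon
  have hT : (⟨p - 1/3, q - 1/3⟩ : ℂ) ≠ 0 := by
    intro h
    have h1 := congrArg Complex.re h
    have h2 := congrArg Complex.im h
    simp only [Complex.zero_re, Complex.zero_im] at h1 h2
    have : p = 1/3 := by linarith
    have : q = 1/3 := by linarith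
    subst p q
    norm_num at hpq
    linarith
  set T : ℂ := ⟨p - 1/3, q - 1/3⟩ with hTd
  obtain ⟨φ, hφ, hφ2⟩ := extraction_forall_of_frequently
    (P := fun k n => Real.pi - 1/((k:ℝ)+1) < |(-(W n) / T).arg|)
    (fun k => by simpa using hcon (1/((k:ℝ)+1)) (by positivity))
  obtain ⟨⟨a, b⟩, hab, ψ, hψ, hlim⟩ := (isCompact_Icc.prod isCompact_Icc :
      IsCompact (Icc (0:ℝ) 1 ×ˢ Icc (0:ℝ) 1)).tendsto_subseq (x := fun n => (x (φ n), y (φ n))) (by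
    intro n
    have := hx (φ n); have := hy (φ n); have := hz (φ n)
    exact ⟨⟨by linarith, by dsimp only; linarith⟩, ⟨by linarith, by dsimp only; linarith⟩⟩)
  have hsub : Tendsto (fun n => φ (ψ n)) atTop atTop := hφ.tendsto_atTop.comp hψ.tendsto_atTop
  have hxa : Tendsto (fun n => x (φ (ψ n))) atTop (𝓝 a) := (continuous_fst.tendsto _).comp hlim
  have hyb : Tendsto (fun n => y (φ (ψ n))) atTop (𝓝 b) := (continuous_snd.tendsto _).comp hlim
  have ha0 : 0 ≤ a := hab.1.1
  have hb0 : 0 ≤ b := hab.2.1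
  have hc0 : 0 ≤ 1 - a - b := ge_of_tendsto' ((hxa.const_sub 1).sub hyb) (fun n => hz _)
  have hprod : a * b * (1 - a - b) = M :=
    tendsto_nhds_unique ((hxa.mul hyb).mul ((hxa.const_sub 1).sub hyb)) (hM.comp hsub)
  have hWl : Tendsto (fun n => W (φ (ψ n))) atTop (𝓝 (⟨a - 1/3, b - 1/3⟩ : ℂ)) := by
    have h1 : Tendsto (fun n => (⟨x (φ (ψ n)) - 1/3, y (φ (ψ n)) - 1/3⟩ : ℂ)) atTop (𝓝 (⟨a - 1/3, b - 1/3⟩ : ℂ)) := by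
      have h2 := (Complex.continuous_ofReal.tendsto _).comp (hxa.sub_const (1/3))
      have h3 := ((Complex.continuous_ofReal.tendsto _).comp (hyb.sub_const (1/3))).mul_const Complex.I
      have h4 := h2.add h3
      simp only [Function.comp_def, ← Complex.mk_eq_add_mul_I] at h4
      exact h4
    have := (hW.comp hsub).add h1
    simpa [Function.comp_def] using this
  have hVl : Tendsto (fun n => -(W (φ (ψ n))) / T) atTop (𝓝 (-(⟨a - 1/3, b - 1/3⟩ : ℂ) / T)) :=
    hWl.neg.div_const T
  by_cases hsl : -(⟨a - 1/3, b - 1/3⟩ : ℂ) / T ∈ Complex.slitPlane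
  · have h1 := ((Complex.continuousAt_arg hsl).tendsto.comp hVl).abs
    have h2 : Tendsto (fun n => Real.pi - 1/((ψ n : ℝ)+1)) atTop (𝓝 (Real.pi - 0)) :=
      ((tendsto_one_div_add_atTop_nhds_zero_nat (𝕜 := ℝ)).comp hψ.tendsto_atTop).const_sub _
    have h3 := le_of_tendsto_of_tendsto' h2 h1 (fun n => (hφ2 (ψ n)).le)
    rw [sub_zero] at h3
    have h4 := (Complex.mem_slitPlane_iff_arg.1 hsl).1
    have h5 := Complex.neg_pi_lt_arg (-(⟨a - 1/3, b - 1/3⟩ : ℂ) / T)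
    have h6 := Complex.arg_le_pi (-(⟨a - 1/3, b - 1/3⟩ : ℂ) / T)
    rcases le_abs.1 h3 with h | h
    · exact h4 (le_antisymm h6 h)
    · linarith
  · rw [Complex.mem_slitPlane_iff] at hsl
    push Not at hsl
    obtain ⟨hre, him⟩ := hsl
    obtain ⟨t, ht⟩ : ∃ t, t = -(-(⟨a - 1/3, b - 1/3⟩ : ℂ) / T).re := ⟨_, rfl⟩
    have hVt : -(⟨a - 1/3, b - 1/3⟩ : ℂ) / T = ((-t : ℝ) : ℂ) := by
      apply Complex.ext
      · simp only [Complex.ofReal_re]; rw [ht, neg_neg]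
      · simp only [Complex.ofReal_im]; exact him
    rw [div_eq_iff hT] at hVt
    have e1 := congrArg Complex.re hVt
    have e2 := congrArg Complex.im hVt
    simp only [Complex.neg_re, Complex.neg_im, Complex.re_ofReal_mul, Complex.im_ofReal_mul, hTd] at e1 e2
    have ea : a = 1/3 + t*(p-1/3) := by linarith
    have eb : b = 1/3 + t*(q-1/3) := by linarith
    have ec : 1 - a - b = 1/3 + t*(1-p-q-1/3) := by rw [ea, eb]; ring
    have ht0 : 0 ≤ t := by linarith
    have htp : 0 < t := by
      rcases ht0.eq_or_lt with h | h
      · exfalso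
        rw [ec, ea, eb, ← h] at hprod
        norm_num at hprod
        linarith
      · exact h
    have hQ : 0 < (p-1/3)^2+(q-1/3)^2+(1-p-q-1/3)^2 := by
      by_contra h
      push Not at h
      have g1 : (p-1/3)^2 = 0 := by nlinarith [sq_nonneg (p-1/3), sq_nonneg (q-1/3), sq_nonneg (1-p-q-1/3)]
      have g2 : (q-1/3)^2 = 0 := by nlinarith [sq_nonneg (p-1/3), sq_nonneg (q-1/3), sq_nonneg (1-p-q-1/3)]
      apply hT
      apply Complex.ext
      · exact pow_eq_zero_iff (two_ne_zero) |>.1 g1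
      · exact pow_eq_zero_iff (two_ne_zero) |>.1 g2
    have := ray_inj (a := p-1/3) (b := q-1/3) (e := 1-p-q-1/3) (s := t) (by ring) htp
      (by rwa [← ea]) (by rwa [← eb]) (by rwa [← ec]) (by linarith) (by linarith) (by linarith) hQ
      (by rw [← ea, ← eb, ← ec, hprod, ← hpq]; ring)
    rw [this] at ea eb
    have e3 : a = p := by linarith
    have e4 : b = q := by linarith
    rw [e3, e4] at hlim
    obtain ⟨n, h1, h2⟩ := ((hlim.eventually hs).and (hsub.eventually hav)).exists
    exact h2 h1

lemma cluster {x y u v e : ℕ → ℝ} {M p q : ℝ} (hx : ∀ n, 0 ≤ x n) (hy : ∀ n, 0 ≤ y n)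
    (hz : ∀ n, 0 ≤ 1 - x n - y n)
    (hu : Tendsto (fun n => u n - x n) atTop (𝓝 0)) (hv : Tendsto (fun n => v n - y n) atTop (𝓝 0))
    (hus : ∀ n, u (n+1) = u n + 2 * x n * (1 - x n - y n - y n) * e n)
    (hvs : ∀ n, v (n+1) = v n + 2 * y n * (x n - (1 - x n - y n)) * e n)
    (he0 : ∀ n, 0 < e n) (he : Tendsto e atTop (𝓝 0))
    (hs : Tendsto (fun n => ∑ k ∈ Finset.range n, e k) atTop atTop)
    (hM : Tendsto (fun n => x n * y n * (1 - x n - y n)) atTop (𝓝 M)) (hM0 : 0 < M) (hM1 : M < 1/27)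
    (hp : 0 ≤ p) (hq : 0 ≤ q) (hr : 0 ≤ 1 - p - q) (hpq : p * q * (1 - p - q) = M) :
    MapClusterPt (p, q) atTop (fun n => (x n, y n)) := by
  by_contra hcon
  rw [mapClusterPt_iff_frequently] at hcon
  push Not at hcon
  obtain ⟨s, hs1, hs2⟩ := hcon
  have hcpos : 0 < 3*M*(1-27*M) := by
    have : 0 < 1 - 27*M := by linarith
    positivity
  set c := 3*M*(1-27*M) with hc
  have hx1 : ∀ n, x n ≤ 1 := fun n => by linarith [hx n, hy n, hz n]
  have hy1 : ∀ n, y n ≤ 1 := fun n => by linarith [hx n, hy n, hz n]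
  set f : ℕ → ℂ := fun n => ⟨2 * x n * (1 - x n - y n - y n), 2 * y n * (x n - (1 - x n - y n))⟩ with hf
  set W : ℕ → ℂ := fun n => ⟨u n - 1/3, v n - 1/3⟩ with hW
  have hWl : Tendsto (fun n => W n - (⟨x n - 1/3, y n - 1/3⟩ : ℂ)) atTop (𝓝 0) := by
    have h2 := (Complex.continuous_ofReal.tendsto _).comp hu
    have h3 := ((Complex.continuous_ofReal.tendsto _).comp hv).mul_const Complex.I
    have h4 := h2.add h3
    simp only [Complex.ofReal_zero, zero_mul, add_zero] at h4
    refine h4.congr (fun n => ?_)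
    simp only [Function.comp_def, ← Complex.mk_eq_add_mul_I, hW]
    apply Complex.ext <;> simp
  obtain ⟨κ, hκ, harg⟩ := avoid hx hy hz hWl hM hM1 hp hq hr hpq hs1 (by simpa using hs2)
  have hf1 : ∀ n, |(f n).re| ≤ 2 ∧ |(f n).im| ≤ 2 := by
    intro n
    have a1 := hx n; have a2 := hy n; have a3 := hz n; have a4 := hx1 n; have a5 := hy1 n
    have key : ∀ s t : ℝ, 0 ≤ s → s ≤ 1 → -1 ≤ t → t ≤ 1 → |2*s*t| ≤ 2 := by
      intro s t h1 h2 h3 h4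
      rw [abs_mul, abs_of_nonneg (by linarith : 0 ≤ 2*s)]
      have := abs_le.2 ⟨h3, h4⟩
      nlinarith [abs_nonneg t]
    exact ⟨key _ _ a1 a4 (by linarith) (by linarith), key _ _ a2 a5 (by linarith) (by linarith)⟩
  have hfn : ∀ n, ‖f n‖ ≤ 4 := fun n => by
    have := Complex.norm_le_abs_re_add_abs_im (f n)
    linarith [(hf1 n).1, (hf1 n).2]
  have hlow : ∀ᶠ n in atTop, 2*c/3 < 3*(x n * y n * (1 - x n - y n))*(1-27*(x n * y n * (1 - x n - y n))) := by
    have : Tendsto (fun n => 3*(x n * y n * (1 - x n - y n))*(1-27*(x n * y n * (1 - x n - y n)))) atTop (𝓝 c) :=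
      (hM.const_mul 3).mul ((hM.const_mul 27).const_sub 1)
    exact this.eventually (lt_mem_nhds (by linarith))
  have hsmall : ∀ {w : ℕ → ℝ}, Tendsto w atTop (𝓝 0) → ∀ δ > 0, ∀ᶠ n in atTop, |w n| < δ := by
    intro w hw δ hδ
    have := hw.abs
    rw [abs_zero] at this
    exact this.eventually (gt_mem_nhds hδ)
  have hcross : ∀ᶠ n in atTop, c/3 ≤ (f n).im * (W n).re - (f n).re * (W n).im := by
    filter_upwards [hlow, hsmall hu (c/12) (by linarith), hsmall hv (c/12) (by linarith)] with n h1 h2 h3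
    have h4 := cross_ge (hx n) (hy n) (hz n) (by ring)
    have e1 : (f n).im * (W n).re - (f n).re * (W n).im =
      ((x n-1/3)*(2*y n*(x n-(1 - x n - y n))) - (y n-1/3)*(2*x n*((1 - x n - y n)-y n)))
        + (f n).im * (u n - x n) - (f n).re * (v n - y n) := by
      simp only [hf, hW]; ring
    have h5 : |(f n).im * (u n - x n)| ≤ 2 * (c/12) := by
      rw [abs_mul]; exact mul_le_mul (hf1 n).2 h2.le (abs_nonneg _) (by norm_num)
    have h6 : |(f n).re * (v n - y n)| ≤ 2 * (c/12) := by
      rw [abs_mul]; exact mul_le_mul (hf1 n).1 h3.le (abs_nonneg _) (by norm_num)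
    have := (abs_le.1 h5).1
    have := (abs_le.1 h6).2
    rw [e1]; linarith
  have hWup : ∀ᶠ n in atTop, ‖W n‖ ≤ 4 := by
    filter_upwards [hsmall hu 1 one_pos, hsmall hv 1 one_pos] with n h2 h3
    have h := Complex.norm_le_abs_re_add_abs_im (W n)
    have h2 := abs_lt.1 h2
    have h3 := abs_lt.1 h3
    have i1 : |(W n).re| ≤ 2 := abs_le.2 ⟨by simp only [hW]; linarith [hx n, hx1 n], by simp only [hW]; linarith [hx n, hx1 n]⟩
    have i2 : |(W n).im| ≤ 2 := abs_le.2 ⟨by simp only [hW]; linarith [hy n, hy1 n], by simp only [hW]; linarith [hy n, hy1 n]⟩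
    linarith
  have hWlow : ∀ᶠ n in atTop, c/12 ≤ ‖W n‖ := by
    filter_upwards [hcross] with n h
    have i1 := Complex.abs_re_le_norm (W n)
    have i2 := Complex.abs_im_le_norm (W n)
    have h5 : |(f n).im * (W n).re| ≤ 2 * ‖W n‖ := by
      rw [abs_mul]; exact mul_le_mul (hf1 n).2 i1 (abs_nonneg _) (by norm_num)
    have h6 : |(f n).re * (W n).im| ≤ 2 * ‖W n‖ := by
      rw [abs_mul]; exact mul_le_mul (hf1 n).1 i2 (abs_nonneg _) (by norm_num)
    have := (abs_le.1 h5).2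
    have := (abs_le.1 h6).1
    linarith
  have hW0 : ∀ᶠ n in atTop, W n ≠ 0 := by
    filter_upwards [hWlow] with n h h0
    rw [h0, norm_zero] at h; linarith
  have hT : (⟨p - 1/3, q - 1/3⟩ : ℂ) ≠ 0 := by
    intro h
    have h1 := congrArg Complex.re h
    have h2 := congrArg Complex.im h
    simp only [Complex.zero_re, Complex.zero_im] at h1 h2
    have : p = 1/3 := by linarith
    have : q = 1/3 := by linarith
    subst p q
    norm_num at hpq
    linarith
  refine winding (V := fun n => -(W n) / (⟨p - 1/3, q - 1/3⟩ : ℂ)) (η := fun n => (e n : ℂ) * (f n / W n))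
    (c := c/48) (K := 48/c) hκ (by positivity) ?_ ?_ he0 he hs ?_ ?_ harg
  · filter_upwards [hW0] with n h
    exact div_ne_zero (neg_ne_zero.2 h) hT
  · filter_upwards [hW0] with n h
    have : W (n+1) = W n + e n * f n := by
      apply Complex.ext
      · simp only [hW, hf, Complex.add_re, Complex.re_ofReal_mul, hus]; ring
      · simp only [hW, hf, Complex.add_im, Complex.im_ofReal_mul, hvs]; ring
    rw [this]
    field_simp
  · filter_upwards [hWlow] with n h
    rw [norm_mul, norm_div, Complex.norm_real, Real.norm_of_nonneg (he0 n).le, mul_comm]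
    refine mul_le_mul_of_nonneg_right ?_ (he0 n).le
    rw [div_le_div_iff₀ (by linarith) hcpos]
    have := hfn n
    nlinarith
  · filter_upwards [hcross, hWup, hW0] with n h1 h2 h3
    rw [Complex.im_ofReal_mul, mul_comm]
    refine mul_le_mul_of_nonneg_left ?_ (he0 n).le
    have hn : 0 < Complex.normSq (W n) := Complex.normSq_pos.2 h3
    have hn2 : Complex.normSq (W n) ≤ 16 := by
      rw [Complex.normSq_eq_norm_sq]; nlinarith [norm_nonneg (W n)]
    rw [Complex.div_im, ← sub_div, le_div_iff₀ hn]
    nlinarith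

end RPSChain

set_option linter.unusedSectionVars false
namespace RPSChain
variable {Ω : Type*} [MeasurableSpace Ω] {μ : Measure Ω} {γ₀ : ℝ}

lemma path_cluster (hγ : 2 ≤ γ₀) (c : RPSChain μ γ₀) {ω : Ω} {M lX lY : ℝ}
    (hX : Tendsto (fun n => c.NN 1 0 n ω) atTop (𝓝 lX))
    (hY : Tendsto (fun n => c.NN 0 1 n ω) atTop (𝓝 lY))
    (hM : Tendsto (fun n => c.X n ω * c.Y n ω * c.Z n ω) atTop (𝓝 M)) (hM0 : 0 < M) (hM1 : M < 1/27)
    (p : ℝ × ℝ × ℝ) :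
    MapClusterPt p atTop (fun n => (c.X n ω, c.Y n ω, c.Z n ω)) ↔
          (0 ≤ p.1 ∧ 0 ≤ p.2.1 ∧ 0 ≤ p.2.2 ∧ p.1 + p.2.1 + p.2.2 = 1 ∧
            p.1 * p.2.1 * p.2.2 = M) := by
  obtain ⟨p, q, r⟩ := p
  have hZ : ∀ n, c.Z n ω = 1 - c.X n ω - c.Y n ω := fun n => by linarith [c.sum_eq_one n ω]
  constructor
  · intro h
    obtain ⟨φ, hφ, hl⟩ := h.tendsto_subseq
    have h1 : Tendsto (fun n => c.X (φ n) ω) atTop (𝓝 p) := (continuous_fst.tendsto _).comp hl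
    have h2 : Tendsto (fun n => c.Y (φ n) ω) atTop (𝓝 q) :=
      ((continuous_fst.comp continuous_snd).tendsto _).comp hl
    have h3 : Tendsto (fun n => c.Z (φ n) ω) atTop (𝓝 r) :=
      ((continuous_snd.comp continuous_snd).tendsto _).comp hl
    refine ⟨ge_of_tendsto' h1 (fun n => c.nonneg_X _ _), ge_of_tendsto' h2 (fun n => c.nonneg_Y _ _),
      ge_of_tendsto' h3 (fun n => c.nonneg_Z _ _), ?_, ?_⟩
    · have := (h1.add h2).add h3
      simp only [c.sum_eq_one] at this
      exact tendsto_nhds_unique this tendsto_const_nhds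
    · exact tendsto_nhds_unique ((h1.mul h2).mul h3) (hM.comp hφ.tendsto_atTop)
  · rintro ⟨hp, hq, hr, hs, hm⟩
    simp only at hp hq hr hs hm
    have er : r = 1 - p - q := by linarith
    subst er
    have hcl : MapClusterPt (p, q) atTop (fun n => (c.X n ω, c.Y n ω)) := by
      refine cluster (u := fun n => c.X n ω - c.NN 1 0 n ω + lX) (v := fun n => c.Y n ω - c.NN 0 1 n ω + lY)
        (e := fun n => 1/rpsGamma γ₀ (n+1)) (M := M) (fun n => c.nonneg_X _ _) (fun n => c.nonneg_Y _ _)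
        (fun n => by rw [← hZ]; exact c.nonneg_Z _ _) ?_ ?_ ?_ ?_ ?_ ?_ (sum_gam hγ 1) ?_ hM0 hM1 hp hq hr hm
      · have := hX.const_sub lX
        rw [sub_self] at this
        exact this.congr (fun n => by ring)
      · have := hY.const_sub lY
        rw [sub_self] at this
        exact this.congr (fun n => by ring)
      · intro n
        simp only [NN, Finset.sum_range_succ, dN, hZ]; ring
      · intro n
        simp only [NN, Finset.sum_range_succ, dN, hZ]; ring
      · intro n
        have := gam_ge hγ (n+1)
        positivity
      · exact (gam_inv γ₀).comp (tendsto_add_atTop_nat 1)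
      · simpa only [hZ] using hM
    have hc : Continuous (fun a : ℝ × ℝ => (a.1, a.2, 1 - a.1 - a.2)) := by fun_prop
    have := hcl.continuousAt_comp hc.continuousAt
    simpa only [hZ, Function.comp_def] using this

end RPSChain

/-- Almost surely `M_n = X_n Y_n Z_n` converges to a limit `M ∈ (0, 1/27)`, the sequence
`(X_n, Y_n, Z_n)` does not converge, and its set of cluster points is exactly
`{(x,y,z) ∈ Δ² : xyz = M}`.  Moreover the law of `M` gives positive probability to every
nonempty open subinterval of `(0, 1/27)`. -/
theorem rps_main
    {Ω : Type*} [MeasurableSpace Ω] (μ : Measure Ω) [IsProbabilityMeasure μ]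
    (γ₀ : ℝ) (hγ₀ : 2 ≤ γ₀) (c : RPSChain μ γ₀) :
    (∀ᵐ ω ∂μ, ∃ M : ℝ, M ∈ Set.Ioo (0 : ℝ) (1/27) ∧
      Tendsto (fun n => c.X n ω * c.Y n ω * c.Z n ω) atTop (𝓝 M) ∧
      (¬ ∃ p : ℝ × ℝ × ℝ, Tendsto (fun n => (c.X n ω, c.Y n ω, c.Z n ω)) atTop (𝓝 p)) ∧
      (∀ p : ℝ × ℝ × ℝ,
        MapClusterPt p atTop (fun n => (c.X n ω, c.Y n ω, c.Z n ω)) ↔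
          (0 ≤ p.1 ∧ 0 ≤ p.2.1 ∧ 0 ≤ p.2.2 ∧ p.1 + p.2.1 + p.2.2 = 1 ∧
            p.1 * p.2.1 * p.2.2 = M))) ∧
    (∀ a b : ℝ, 0 ≤ a → a < b → b ≤ 1/27 →
      0 < μ {ω | ∃ M ∈ Set.Ioo a b,
        Tendsto (fun n => c.X n ω * c.Y n ω * c.Z n ω) atTop (𝓝 M)}) := by
  obtain ⟨L, hL'⟩ := RPSChain.exists_lim hγ₀ c
  have hL : c.IsLim L := hL'
  constructor
  · filter_upwards [hL.2.2, hL.pos hγ₀, hL.lt hγ₀,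
      RPSChain.NN_conv hγ₀ c (α := 1) (β := 0) zero_le_one le_rfl le_rfl zero_le_one,
      RPSChain.NN_conv hγ₀ c (α := 0) (β := 1) le_rfl zero_le_one zero_le_one le_rfl]
      with ω h1 h2 h3 ⟨lX, h4⟩ ⟨lY, h5⟩
    have hcl := RPSChain.path_cluster hγ₀ c h4 h5 h1 h2 h3
    refine ⟨L ω, ⟨h2, h3⟩, h1, ?_, hcl⟩
    rintro ⟨⟨p, q, r⟩, hp⟩
    obtain ⟨g1, g2, g3, g4, g5⟩ := (hcl _).1 hp.mapClusterPt
    simp only at g1 g2 g3 g4 g5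
    have hrot := (hcl (q, r, p)).2 ⟨g2, g3, g1, by simp only; linarith, by simp only; linarith⟩
    obtain ⟨φ, hφ, hl⟩ := hrot.tendsto_subseq
    have := tendsto_nhds_unique hl (hp.comp hφ.tendsto_atTop)
    simp only [Prod.mk.injEq] at this
    obtain ⟨e1, e2, e3⟩ := this
    have k1 : p = 1/3 := by linarith
    have k2 : q = 1/3 := by linarith
    have k3 : r = 1/3 := by linarith
    rw [k1, k2, k3] at g5
    norm_num at g5
    linarith
  · intro a b ha hab hb
    rw [pos_iff_ne_zero]
    intro h0
    apply hL.supp hγ₀ ha hab hb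
    have h0' : ∀ᵐ ω ∂μ, ¬ ∃ M ∈ Set.Ioo a b,
        Tendsto (fun n => c.X n ω * c.Y n ω * c.Z n ω) atTop (𝓝 M) := by
      rw [ae_iff]; simpa only [not_not] using h0
    filter_upwards [h0', hL.2.2] with ω k1 k2 k3
    exact k1 ⟨_, k3, k2⟩
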